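/- Every countable nonamenable discrete group Γ admits uncountably many pairwise non-orbit-equivalent free ergodic pmp actions on a nonatomic standard probability space. -/

import Mathlib

open MeasureTheory Set BoundedContinuousFunction

noncomputable section

/-- A (discrete) group `G` is amenable if there is a left-invariant mean on `ℓ^∞(G)`:
a positive unital linear functional `φ` with `φ (g · f) = φ f`, where
`(g · f) h = f (g⁻¹ h)`. -/
def IsAmenable (G : Type*) [Group G] : Prop :=
  letI : TopologicalSpace G := ⊥
  haveI : DiscreteTopology G := ⟨rfl⟩
  ∃ φ : (G →ᵇ ℝ) →ₗ[ℝ] ℝ,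
    (∀ f : G →ᵇ ℝ, (∀ x, 0 ≤ f x) → 0 ≤ φ f) ∧
    φ 1 = 1 ∧
    ∀ (g : G) (f : G →ᵇ ℝ),
      φ (f.compContinuous ⟨fun h => g⁻¹ * h, continuous_of_discreteTopology⟩) = φ f

/-- A probability-measure-preserving action of the group `G` on `(X, μ)`. -/
structure PmpAction (G X : Type*) [Group G] [MeasurableSpace X] (μ : Measure X) where
  act : G → X → X
  act_one : ∀ x, act 1 x = x
  act_mul : ∀ g h x, act (g * h) x = act g (act h x)
  measurable : ∀ g, Measurable (act g)
  measurePreserving : ∀ g, MeasurePreserving (act g) μ μ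

variable {G X Y : Type*} [Group G] [MeasurableSpace X] [MeasurableSpace Y]
  {μ : Measure X} {ν : Measure Y}

/-- The action is (essentially) free. -/
def PmpAction.IsFree (A : PmpAction G X μ) : Prop :=
  ∀ᵐ x ∂μ, ∀ g : G, A.act g x = x → g = 1

/-- The action is ergodic: every invariant measurable set is null or conull. -/
def PmpAction.IsErgodic (A : PmpAction G X μ) : Prop :=
  ∀ s : Set X, MeasurableSet s → (∀ g, A.act g ⁻¹' s = s) → μ s = 0 ∨ μ sᶜ = 0

/-- The orbit `G x` of a point. -/
def PmpAction.orbit (A : PmpAction G X μ) (x : X) : Set X :=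
  {y | ∃ g : G, y = A.act g x}

/-- Two pmp actions are orbit equivalent if there is a measure-preserving Borel isomorphism
`Δ` with `Δ(G x) = H (Δ x)` for almost every `x`. -/
def OrbitEquivalent {H : Type*} [Group H] (A : PmpAction G X μ) (B : PmpAction H Y ν) :
    Prop :=
  ∃ Δ : X ≃ Y, Measurable ⇑Δ ∧ Measurable ⇑Δ.symm ∧ MeasurePreserving ⇑Δ μ ν ∧
    ∀ᵐ x ∂μ, ⇑Δ '' A.orbit x = B.orbit (Δ x)

section Auxiliary

open Filter Topology
open scoped ENNReal NNReal

theorem isAmenable_of_almost_invariant {Γ : Type*} [Group Γ]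
    (h : ∀ (S : Finset Γ) (c : ℝ), 0 < c → ∃ f : Γ → ℝ, (∀ g, 0 ≤ f g) ∧ HasSum f 1 ∧
      ∀ t ∈ S, ∑' g, |f (t * g) - f g| ≤ c) : IsAmenable Γ := by
  classical
  let : TopologicalSpace Γ := ⊥
  have : DiscreteTopology Γ := ⟨rfl⟩
  choose! f hf0 hf1 hfi using h
  let w : Finset Γ × ℕ → Γ → ℝ := fun i => f i.1 (1 / ((i.2 : ℝ) + 1))
  have hpos : ∀ i : Finset Γ × ℕ, (0 : ℝ) < 1 / ((i.2 : ℝ) + 1) := fun i => by positivity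
  have w0 : ∀ i g, 0 ≤ w i g := fun i g => hf0 _ _ (hpos i) g
  have w1 : ∀ i, HasSum (w i) 1 := fun i => hf1 _ _ (hpos i)
  have wi : ∀ i, ∀ t ∈ i.1, ∑' g, |w i (t * g) - w i g| ≤ 1 / ((i.2 : ℝ) + 1) :=
    fun i => hfi _ _ (hpos i)
  have hsum : ∀ i (F : Γ →ᵇ ℝ), Summable fun g => w i g * F g := fun i F => by
    refine Summable.of_norm_bounded ((w1 i).summable.mul_right ‖F‖) fun g => ?_
    rw [norm_mul, Real.norm_of_nonneg (w0 i g)]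
    exact mul_le_mul_of_nonneg_left (F.norm_coe_le_norm g) (w0 i g)
  let a : (Γ →ᵇ ℝ) → Finset Γ × ℕ → ℝ := fun F i => ∑' g, w i g * F g
  have ha : ∀ F i, |a F i| ≤ ‖F‖ := fun F i => by
    have h1 : ‖∑' g, w i g * F g‖ ≤ ∑' g, w i g * ‖F‖ := by
      refine tsum_of_norm_bounded ((w1 i).summable.mul_right ‖F‖).hasSum fun g => ?_
      rw [norm_mul, Real.norm_of_nonneg (w0 i g)]
      exact mul_le_mul_of_nonneg_left (F.norm_coe_le_norm g) (w0 i g)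
    rwa [tsum_mul_right, (w1 i).tsum_eq, one_mul] at h1
  let U : Ultrafilter (Finset Γ × ℕ) := Ultrafilter.of atTop
  have hU : (U : Filter (Finset Γ × ℕ)) ≤ atTop := Ultrafilter.of_le _
  have hlim : ∀ F, ∃ x, Tendsto (a F) U (𝓝 x) := fun F => by
    obtain ⟨x, -, hx⟩ := (isCompact_Icc (a := -‖F‖) (b := ‖F‖)).ultrafilter_le_nhds
      (U.map (a F)) (by
        rw [le_principal_iff]
        exact Filter.mem_map.2 (Filter.univ_mem' fun i => abs_le.1 (ha F i)))
    exact ⟨x, hx⟩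
  choose φ hφ using hlim
  refine ⟨{ toFun := φ, map_add' := fun F K => ?_, map_smul' := fun r F => ?_ }, ?_, ?_, ?_⟩
  · refine tendsto_nhds_unique (hφ _) (((hφ F).add (hφ K)).congr fun i => ?_)
    simp only [a, ← (hsum i F).tsum_add (hsum i K), BoundedContinuousFunction.coe_add,
      Pi.add_apply, mul_add]
  · refine tendsto_nhds_unique (hφ _) (((hφ F).const_mul r).congr fun i => ?_)
    simp only [a, ← tsum_mul_left, BoundedContinuousFunction.coe_smul, smul_eq_mul]
    exact tsum_congr fun g => by ring
  · intro F hF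
    exact ge_of_tendsto' (hφ F) fun i => tsum_nonneg fun g => mul_nonneg (w0 i g) (hF g)
  · refine tendsto_nhds_unique (hφ _) (tendsto_const_nhds.congr fun i => ?_)
    simp [a, (w1 i).tsum_eq]
  · intro t F
    refine tendsto_nhds_unique (hφ _) ?_
    have hd : Tendsto (fun i => a (F.compContinuous
        ⟨fun h => t⁻¹ * h, continuous_of_discreteTopology⟩) i - a F i) U (𝓝 0) := by
      have hb : Tendsto (fun i : Finset Γ × ℕ => 1 / ((i.2 : ℝ) + 1) * ‖F‖) U (𝓝 0) := by
        rw [← zero_mul ‖F‖]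
        refine Tendsto.mul_const _ ?_
        exact (tendsto_one_div_add_atTop_nhds_zero_nat (𝕜 := ℝ)).comp
          ((tendsto_snd.mono_left (by rw [← prod_atTop_atTop_eq])).mono_left hU)
      refine squeeze_zero_norm' ?_ hb
      have hev : ∀ᶠ i : Finset Γ × ℕ in U, t ∈ i.1 := by
        refine hU ?_
        filter_upwards [eventually_ge_atTop (({t} : Finset Γ), 0)] with i hi
        exact hi.1 (Finset.mem_singleton_self t)
      filter_upwards [hev] with i hi
      have e1 : a (F.compContinuous ⟨fun h => t⁻¹ * h, continuous_of_discreteTopology⟩) i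
          = ∑' g, w i (t * g) * F g := by
        refine ((Equiv.mulLeft t).tsum_eq _).symm.trans (tsum_congr fun g => ?_)
        simp
      have s1 : Summable fun g => w i (t * g) := (w1 i).summable.comp_injective
          (mul_right_injective t)
      have s2 : Summable fun g => w i (t * g) * F g := by
        refine Summable.of_norm_bounded (s1.mul_right ‖F‖) fun g => ?_
        rw [norm_mul, Real.norm_of_nonneg (w0 i _)]
        exact mul_le_mul_of_nonneg_left (F.norm_coe_le_norm g) (w0 i _)
      rw [e1]
      simp only [a]
      rw [← s2.tsum_sub (hsum i F)]
      have s3 : Summable fun g => |w i (t * g) - w i g| := (s1.sub (w1 i).summable).abs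
      refine (tsum_of_norm_bounded (s3.mul_right ‖F‖).hasSum fun g => ?_).trans ?_
      · rw [← sub_mul, norm_mul]
        exact mul_le_mul_of_nonneg_left (F.norm_coe_le_norm g) (norm_nonneg _)
      · rw [tsum_mul_right]
        exact mul_le_mul_of_nonneg_right (wi i t hi) (norm_nonneg _)
    simpa using hd.add (hφ F)

theorem exists_spectral_gap {Γ : Type*} [Group Γ] (hna : ¬ IsAmenable Γ) :
    ∃ (m : Γ → ℝ≥0∞) (ρ : ℝ≥0∞), ∑' g, m g = 1 ∧ (∀ g, m g⁻¹ = m g) ∧ ρ < 1 ∧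
      ∀ ξ : Γ → ℝ≥0∞, ∑' h, (∑' s, m s * ξ (s * h)) ^ 2 ≤ ρ * ∑' h, ξ h ^ 2 := by
  classical
  by_contra hcon
  push Not at hcon
  refine hna (isAmenable_of_almost_invariant fun S c hc => ?_)
  let S' : Finset Γ := insert 1 (S ∪ S.image (·⁻¹))
  have hone : (1 : Γ) ∈ S' := by simp [S']
  have hinv : ∀ g, g⁻¹ ∈ S' ↔ g ∈ S' := fun g => by
    simp only [S', Finset.mem_insert, inv_eq_one, Finset.mem_union, Finset.mem_image]
    refine or_congr_right ⟨?_, ?_⟩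
    · rintro (h | ⟨a, ha, h⟩)
      · exact Or.inr ⟨_, h, inv_inv g⟩
      · exact Or.inl (inv_injective h ▸ ha)
    · rintro (h | ⟨a, ha, h⟩)
      · exact Or.inr ⟨_, h, rfl⟩
      · exact Or.inl (by rw [← h, inv_inv]; exact ha)
  obtain ⟨n, hn⟩ : ∃ n, n = S'.card := ⟨_, rfl⟩
  have hn0 : 0 < n := hn ▸ Finset.card_pos.2 ⟨1, hone⟩
  have hnR : (0 : ℝ) < n := by exact_mod_cast hn0
  let m : Γ → ℝ≥0∞ := fun g => if g ∈ S' then (n : ℝ≥0∞)⁻¹ else 0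
  have hm : ∀ ψ : Γ → ℝ≥0∞, ∑' s, m s * ψ s = (n : ℝ≥0∞)⁻¹ * ∑ s ∈ S', ψ s := fun ψ => by
    rw [tsum_eq_sum (s := S') fun b hb => by simp [m, hb], Finset.mul_sum]
    exact Finset.sum_congr rfl fun s hs => by simp [m, hs]
  have hnE : (n : ℝ≥0∞) ≠ 0 := by exact_mod_cast hn0.ne'
  have hm1 : ∑' g, m g = 1 := by
    have := hm fun _ => 1
    simp only [mul_one, Finset.sum_const, nsmul_eq_mul] at this
    rw [this, ← hn, ENNReal.inv_mul_cancel hnE (ENNReal.natCast_ne_top n)]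
  set d : ℝ := min (c / 3) (1 / 2) with hd
  have hd0 : 0 < d := by positivity
  set ε : ℝ := d ^ 2 / n ^ 2 with hε
  have hε0 : 0 < ε := by positivity
  have hε1 : ε < 1 := by
    rw [hε, div_lt_one (by positivity)]
    have : (1 : ℝ) ≤ n := by exact_mod_cast hn0
    have : d ≤ 1 / 2 := min_le_right _ _
    nlinarith
  obtain ⟨ξ, hξ⟩ := hcon m (ENNReal.ofReal (1 - ε)) hm1 (fun g => by simp [m, hinv])
    (by rw [← ENNReal.ofReal_one]; exact (ENNReal.ofReal_lt_ofReal_iff one_pos).2 (by linarith))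
  simp only [hm] at hξ
  have hfin : ∑' h, ξ h ^ 2 ≠ ∞ := fun htop => by
    rw [htop, ENNReal.mul_top (by simpa using hε1)] at hξ
    exact not_top_lt hξ
  set x : Γ → ℝ := fun h => (ξ h).toReal with hx
  have hξx : ∀ h, ξ h = ENNReal.ofReal (x h) := fun h => by
    rw [hx, ENNReal.ofReal_toReal]
    intro ht
    exact ENNReal.ne_top_of_tsum_ne_top hfin h (by simp [ht])
  have hx0 : ∀ h, 0 ≤ x h := fun h => ENNReal.toReal_nonneg
  have hsq : ∀ h, ξ h ^ 2 = ENNReal.ofReal (x h ^ 2) := fun h => by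
    rw [hξx, ENNReal.ofReal_pow (hx0 h)]
  have hsx : Summable fun h => x h ^ 2 := by
    have := ENNReal.summable_toReal hfin
    refine this.congr fun h => ?_
    rw [hsq, ENNReal.toReal_ofReal (by positivity)]
  obtain ⟨A, hA⟩ : ∃ A, A = ∑' h, x h ^ 2 := ⟨_, rfl⟩
  have hEA : ∑' h, ξ h ^ 2 = ENNReal.ofReal A := by
    rw [hA, ENNReal.ofReal_tsum_of_nonneg (fun h => by positivity) hsx]
    exact tsum_congr hsq
  have hst : ∀ t, Summable fun h => x (t * h) ^ 2 := fun t =>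
    hsx.comp_injective (mul_right_injective t)
  have htt : ∀ t, ∑' h, x (t * h) ^ 2 = A := fun t =>
    ((Equiv.mulLeft t).tsum_eq fun h => x h ^ 2).trans hA.symm
  let y : Γ → ℝ := fun h => (n : ℝ)⁻¹ * ∑ s ∈ S', x (s * h)
  have hy0 : ∀ h, 0 ≤ y h := fun h =>
    mul_nonneg (by positivity) (Finset.sum_nonneg fun s _ => hx0 _)
  have hEy : ∀ h, ((n : ℝ≥0∞)⁻¹ * ∑ s ∈ S', ξ (s * h)) ^ 2 = ENNReal.ofReal (y h ^ 2) :=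
    fun h => by
      rw [ENNReal.ofReal_pow (hy0 h), ENNReal.ofReal_mul (by positivity),
        ENNReal.ofReal_inv_of_pos hnR, ENNReal.ofReal_natCast,
        ENNReal.ofReal_sum_of_nonneg fun s _ => hx0 _]
      simp only [hξx]
  have hpt : ∀ t ∈ S', ∀ h, (x (t * h) - x h) ^ 2 + n ^ 2 * y h ^ 2
      ≤ n * ∑ s ∈ S', x (s * h) ^ 2 := fun t ht h => by
    have e1 : (n : ℝ) ^ 2 * y h ^ 2 = (∑ s ∈ S', x (s * h)) ^ 2 := by
      simp only [y]; field_simp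
    rw [e1]
    have key : ∑ s ∈ S', ∑ s' ∈ S', (x (s * h) - x (s' * h)) ^ 2
        = 2 * (n * ∑ s ∈ S', x (s * h) ^ 2) - 2 * (∑ s ∈ S', x (s * h)) ^ 2 := by
      simp only [sub_sq, Finset.sum_add_distrib, Finset.sum_sub_distrib, Finset.sum_const,
        nsmul_eq_mul, ← Finset.mul_sum, ← Finset.sum_mul, ← hn, mul_assoc]
      ring
    by_cases h1 : t = 1
    · have : 0 ≤ ∑ s ∈ S', ∑ s' ∈ S', (x (s * h) - x (s' * h)) ^ 2 :=
        Finset.sum_nonneg fun _ _ => Finset.sum_nonneg fun _ _ => sq_nonneg _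
      subst h1
      simp only [one_mul, sub_self]
      linarith
    · have h2 : 2 * (x (t * h) - x h) ^ 2
          ≤ ∑ s ∈ S', ∑ s' ∈ S', (x (s * h) - x (s' * h)) ^ 2 := by
        have hsub : ({t, 1} : Finset Γ) ⊆ S' := by
          intro a ha
          simp only [Finset.mem_insert, Finset.mem_singleton] at ha
          rcases ha with rfl | rfl <;> assumption
        refine le_trans ?_ (Finset.sum_le_sum_of_subset_of_nonneg hsub fun _ _ _ =>
          Finset.sum_nonneg fun _ _ => sq_nonneg _)
        rw [Finset.sum_pair h1]
        have a1 := Finset.single_le_sum (f := fun s' => (x (t * h) - x (s' * h)) ^ 2)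
          (fun _ _ => sq_nonneg _) hone
        have a2 := Finset.single_le_sum (f := fun s' => (x (1 * h) - x (s' * h)) ^ 2)
          (fun _ _ => sq_nonneg _) ht
        simp only [one_mul] at a1 a2 ⊢
        nlinarith
      linarith
  have hsR : Summable fun h => (n : ℝ) * ∑ s ∈ S', x (s * h) ^ 2 :=
    (summable_sum fun s _ => hst s).mul_left _
  have hsy : Summable fun h => y h ^ 2 := by
    refine Summable.of_nonneg_of_le (fun h => sq_nonneg _) (fun h => ?_)
      (hsR.mul_left ((n : ℝ) ^ 2)⁻¹)
    rw [inv_mul_eq_div, le_div_iff₀ (by positivity)]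
    have := hpt 1 hone h
    simp only [one_mul, sub_self] at this
    linarith
  have hgap : (1 - ε) * A < ∑' h, y h ^ 2 := by
    rw [tsum_congr hEy, hEA, ← ENNReal.ofReal_mul (by linarith),
      ← ENNReal.ofReal_tsum_of_nonneg (fun h => sq_nonneg _) hsy] at hξ
    exact (ENNReal.ofReal_lt_ofReal_iff').1 hξ |>.1
  have hAsum : ∑' h, (n : ℝ) * ∑ s ∈ S', x (s * h) ^ 2 = n ^ 2 * A := by
    rw [tsum_mul_left, Summable.tsum_finsetSum fun s _ => hst s]
    simp only [htt, Finset.sum_const, nsmul_eq_mul, ← hn]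
    ring
  have hdiff : ∀ t ∈ S', Summable (fun h => (x (t * h) - x h) ^ 2) ∧
      ∑' h, (x (t * h) - x h) ^ 2 ≤ d ^ 2 * A := fun t ht => by
    have s1 : Summable fun h => (x (t * h) - x h) ^ 2 := by
      refine Summable.of_nonneg_of_le (fun h => sq_nonneg _) (fun h => ?_) hsR
      have := hpt t ht h
      have : 0 ≤ (n : ℝ) ^ 2 * y h ^ 2 := by positivity
      linarith
    refine ⟨s1, ?_⟩
    have h1 := (s1.add (hsy.mul_left ((n : ℝ) ^ 2))).tsum_le_tsum (hpt t ht) hsR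
    rw [s1.tsum_add (hsy.mul_left _), hAsum, tsum_mul_left] at h1
    have h2 : (n : ℝ) ^ 2 * ((1 - ε) * A) ≤ n ^ 2 * ∑' h, y h ^ 2 :=
      mul_le_mul_of_nonneg_left hgap.le (by positivity)
    have h3 : (n : ℝ) ^ 2 * ε = d ^ 2 := by rw [hε]; field_simp
    have h4 : (n : ℝ) ^ 2 * ((1 - ε) * A) = n ^ 2 * A - d ^ 2 * A := by rw [← h3]; ring
    linarith
  have hA0 : 0 < A := by
    refine (hA ▸ tsum_nonneg fun h => sq_nonneg (x h) : 0 ≤ A).lt_of_ne fun h0 => ?_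
    have h1 : ∑' h, (n : ℝ) * ∑ s ∈ S', x (s * h) ^ 2 = 0 := by rw [hAsum, ← h0, mul_zero]
    have h2 := (hsy.mul_left ((n : ℝ) ^ 2)).tsum_le_tsum (fun h => ?_) hsR
    · rw [h1, tsum_mul_left] at h2
      have h4 : (0 : ℝ) < n ^ 2 := by positivity
      rw [← h0, mul_zero] at hgap
      have := mul_pos h4 hgap
      linarith
    · have := hpt 1 hone h
      simp only [one_mul, sub_self] at this
      linarith
  refine ⟨fun h => x h ^ 2 / A, fun h => by positivity, ?_, fun t ht => ?_⟩
  · have := hsx.hasSum.div_const A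
    rwa [← hA, div_self hA0.ne'] at this
  · obtain ⟨s1, b1⟩ := hdiff t (by simp [S', ht])
    have hb : ∀ h, |x (t * h) ^ 2 / A - x h ^ 2 / A|
        ≤ ((x (t * h) - x h) ^ 2 / (2 * d) + d * (x (t * h) ^ 2 + x h ^ 2)) / A := fun h => by
      rw [← sub_div, abs_div, abs_of_pos hA0]
      refine div_le_div_of_nonneg_right ?_ hA0.le
      have e : x (t * h) ^ 2 - x h ^ 2 = (x (t * h) - x h) * (x (t * h) + x h) := by ring
      rw [e, abs_mul, ← sq_abs (x (t * h) - x h), abs_of_nonneg (add_nonneg (hx0 (t * h)) (hx0 h))]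
      have q : |x (t * h) - x h| * (x (t * h) + x h) ≤
          |x (t * h) - x h| ^ 2 / (2 * d) + d / 2 * (x (t * h) + x h) ^ 2 := by
        have := sq_nonneg (|x (t * h) - x h| - d * (x (t * h) + x h))
        rw [div_add' _ _ _ (by positivity), le_div_iff₀ (by positivity)]
        nlinarith
      have : d * (x (t * h) - x h) ^ 2 ≥ 0 := by positivity
      nlinarith
    have sR : Summable fun h =>
        ((x (t * h) - x h) ^ 2 / (2 * d) + d * (x (t * h) ^ 2 + x h ^ 2)) / A :=
      ((s1.div_const _).add (((hst t).add hsx).mul_left d)).div_const A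
    have sL := Summable.of_nonneg_of_le (fun h => abs_nonneg _) hb sR
    refine (sL.tsum_le_tsum hb sR).trans ?_
    rw [tsum_div_const, (s1.div_const _).tsum_add (((hst t).add hsx).mul_left d), tsum_div_const,
      tsum_mul_left, (hst t).tsum_add hsx, htt, ← hA, div_le_iff₀ hA0]
    have h3 : (∑' h, (x (t * h) - x h) ^ 2) / (2 * d) ≤ d / 2 * A := by
      rw [div_le_iff₀ (by positivity)]
      nlinarith
    have h4 : d ≤ c / 3 := min_le_left _ _
    nlinarith

theorem exists_small_spectral_radius {Γ : Type*} [Group Γ] (hna : ¬ IsAmenable Γ)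
    {c : ℝ≥0∞} (hc : 0 < c) :
    ∃ m : Γ → ℝ≥0∞, ∑' g, m g = 1 ∧ (∀ g, m g⁻¹ = m g) ∧
      ∀ ξ : Γ → ℝ≥0∞, ∑' h, (∑' s, m s * ξ (s * h)) ^ 2 ≤ c * ∑' h, ξ h ^ 2 := by
  obtain ⟨m₀, ρ, hm1, hms, hρ, hgap⟩ := exists_spectral_gap hna
  have key : ∀ n : ℕ, ∃ m : Γ → ℝ≥0∞, ∑' g, m g = 1 ∧ (∀ g, m g⁻¹ = m g) ∧
      ∀ ξ : Γ → ℝ≥0∞, ∑' h, (∑' s, m s * ξ (s * h)) ^ 2 ≤ ρ ^ (2 ^ n) * ∑' h, ξ h ^ 2 := by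
    intro n
    induction n with
    | zero => exact ⟨m₀, hm1, hms, by simpa using hgap⟩
    | succ n ih =>
      obtain ⟨m, h1, h2, h3⟩ := ih
      have hconv : ∀ (ξ : Γ → ℝ≥0∞) h, ∑' u, (∑' s, m s * m (u * s⁻¹)) * ξ (u * h)
          = ∑' s, m s * ∑' t, m t * ξ (t * (s * h)) := fun ξ h => by
        simp only [← ENNReal.tsum_mul_right, ← ENNReal.tsum_mul_left]
        rw [ENNReal.tsum_comm]
        refine tsum_congr fun s => ?_
        rw [← (Equiv.mulRight s).tsum_eq]
        refine tsum_congr fun t => ?_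
        simp [mul_assoc]
      refine ⟨fun u => ∑' s, m s * m (u * s⁻¹), ?_, fun u => ?_, fun ξ => ?_⟩
      · have := hconv (fun _ => 1) 1
        simpa [h1] using this
      · refine ((Equiv.mulRight u⁻¹).tsum_eq _).symm.trans (tsum_congr fun s => ?_)
        rw [mul_comm, ← h2 (Equiv.mulRight u⁻¹ s)]
        simp [h2]
      · simp only [hconv]
        rw [pow_succ, pow_mul, sq (ρ ^ _), mul_assoc]
        refine le_trans ?_ (mul_le_mul_right (h3 ξ) _)
        exact h3 fun h => ∑' t, m t * ξ (t * h)
  have ht : Tendsto (fun n : ℕ => ρ ^ (2 ^ n)) atTop (𝓝 0) :=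
    (ENNReal.tendsto_pow_atTop_nhds_zero_of_lt_one hρ).comp
      (tendsto_pow_atTop_atTop_of_one_lt one_lt_two)
  obtain ⟨n, hn⟩ := (ht.eventually (gt_mem_nhds hc)).exists
  obtain ⟨m, h1, h2, h3⟩ := key n
  exact ⟨m, h1, h2, fun ξ => (h3 ξ).trans (mul_le_mul_left hn.le _)⟩

/-- The `n`-step distribution of the random walk with step distribution `m`. -/
def stepDist {Γ : Type*} [Group Γ] (m : Γ → ℝ≥0∞) : ℕ → Γ → ℝ≥0∞
  | 0 => ({1} : Set Γ).indicator 1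
  | n + 1 => fun h => ∑' s, m s * stepDist m n (s * h)

theorem tsum_stepDist {Γ : Type*} [Group Γ] {m : Γ → ℝ≥0∞} (hm : ∑' g, m g = 1) (n : ℕ) :
    ∑' g, stepDist m n g = 1 := by
  induction n with
  | zero =>
    rw [tsum_eq_single 1 fun g hg => by simp [stepDist, hg]]
    simp [stepDist]
  | succ n ih =>
    simp only [stepDist]
    rw [ENNReal.tsum_comm, ← hm]
    refine tsum_congr fun s => ?_
    have e : ∑' i, stepDist m n (s * i) = 1 := ((Equiv.mulLeft s).tsum_eq _).trans ih
    rw [ENNReal.tsum_mul_left, e, mul_one]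

theorem tsum_stepDist_sq_le {Γ : Type*} [Group Γ] {m : Γ → ℝ≥0∞} {c : ℝ≥0∞}
    (h : ∀ ξ : Γ → ℝ≥0∞, ∑' h, (∑' s, m s * ξ (s * h)) ^ 2 ≤ c * ∑' h, ξ h ^ 2) (n : ℕ) :
    ∑' g, stepDist m n g ^ 2 ≤ c ^ n := by
  induction n with
  | zero =>
    rw [tsum_eq_single 1 fun g hg => by simp [stepDist, hg]]
    simp [stepDist]
  | succ n ih =>
    refine (h (stepDist m n)).trans ?_
    rw [pow_succ, mul_comm]
    exact mul_le_mul_left ih c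

theorem exists_rapidly_decaying_walk {Γ : Type*} [Group Γ] [Countable Γ] (hna : ¬ IsAmenable Γ)
    (C : ℝ≥0) {η : ℝ≥0∞} (hη : 0 < η) :
    ∃ m : Γ → ℝ≥0∞, ∑' g, m g = 1 ∧ (∀ g, m g⁻¹ = m g) ∧
      ∑' n : ℕ, (C : ℝ≥0∞) ^ (n + 1) * stepDist m (n + 1) 1 ≤ η ∧
      Tendsto (fun g => ∑' n : ℕ, (C : ℝ≥0∞) ^ n * stepDist m n g) cofinite (𝓝 0) := by
  obtain ⟨q, hq0, hq⟩ : ∃ q : ℝ≥0∞, 0 < q ∧ C * q ≤ min (1 / 2) (η / 2) := by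
    refine ⟨min (1 / 2) (η / 2) / (C + 1), ENNReal.div_pos ?_ ?_, ?_⟩
    · exact (lt_min (by simp) (ENNReal.div_pos hη.ne' (by simp))).ne'
    · simp
    · rw [← mul_div_assoc]
      refine ENNReal.div_le_of_le_mul ?_
      rw [mul_comm]
      exact mul_le_mul_right (by simp) _
  obtain ⟨m, h1, h2, h3⟩ := exists_small_spectral_radius hna (c := q ^ 2) (by positivity)
  have hw : ∀ n g, stepDist m n g ≤ q ^ n := fun n g => by
    have := (ENNReal.le_tsum g).trans (tsum_stepDist_sq_le h3 n)
    rw [← pow_mul, mul_comm, pow_mul] at this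
    exact (ENNReal.pow_le_pow_left_iff two_ne_zero).1 this
  have hb : ∀ n g, (C : ℝ≥0∞) ^ n * stepDist m n g ≤ (C * q) ^ n := fun n g => by
    rw [mul_pow]
    exact mul_le_mul_right (hw n g) _
  have hC2 : (C : ℝ≥0∞) * q ≤ 2⁻¹ := by simpa using hq.trans (min_le_left _ _)
  refine ⟨m, h1, h2, ?_, ?_⟩
  · calc ∑' n : ℕ, (C : ℝ≥0∞) ^ (n + 1) * stepDist m (n + 1) 1
        ≤ ∑' n : ℕ, 2⁻¹ ^ n * (η / 2) := by
          refine ENNReal.tsum_le_tsum fun n => (hb _ _).trans ?_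
          rw [pow_succ]
          exact mul_le_mul' (pow_le_pow_left₀ zero_le hC2 n) (hq.trans (min_le_right _ _))
      _ = η := by
          rw [ENNReal.tsum_mul_right, ENNReal.tsum_geometric, ENNReal.one_sub_inv_two, inv_inv]
          exact ENNReal.mul_div_cancel two_ne_zero ENNReal.ofNat_ne_top
  · have : (cofinite : Filter Γ).IsCountablyGenerated :=
      HasCountableBasis.isCountablyGenerated ⟨hasBasis_cofinite, Countable.ofPred_finite⟩
    have key := tendsto_lintegral_filter_of_dominated_convergence (l := (cofinite : Filter Γ))
      (μ := Measure.count) (F := fun g n => (C : ℝ≥0∞) ^ n * stepDist m n g) (f := fun _ => 0)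
      (fun n : ℕ => 2⁻¹ ^ n) (.of_forall fun g => measurable_of_countable _)
      (.of_forall fun g => .of_forall fun n => (hb n g).trans (pow_le_pow_left₀ zero_le hC2 n))
      (by rw [lintegral_count, ENNReal.tsum_geometric]; simp)
      (.of_forall fun n => by
        have := ENNReal.tendsto_cofinite_zero_of_tsum_ne_top (f := stepDist m n)
          (by rw [tsum_stepDist h1]; simp)
        simpa using ENNReal.Tendsto.const_mul this (.inr (by simp : (C : ℝ≥0∞) ^ n ≠ ∞)))
    simpa [lintegral_count] using key

section Walks

variable {V E F : Type*}

/-- The vertex at which the oriented edge `s` starts. -/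
def stepStart (src tgt : E → V) (s : E × Bool) : V := bif s.2 then src s.1 else tgt s.1

/-- The vertex at which the oriented edge `s` ends. -/
def stepEnd (src tgt : E → V) (s : E × Bool) : V := bif s.2 then tgt s.1 else src s.1

/-- `l` is a walk from `v` to `w` in the directed multigraph with source map `src` and target map
`tgt`; edges may be traversed backwards. -/
def IsWalk (src tgt : E → V) : V → List (E × Bool) → V → Prop
  | v, [], w => v = w
  | v, s :: l, w => v = stepStart src tgt s ∧ IsWalk src tgt (stepEnd src tgt s) l w

/-- The same edge, with the opposite orientation. -/
def stepFlip (s : E × Bool) : E × Bool := (s.1, !s.2)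

/-- The reversed walk. -/
def walkReverse (l : List (E × Bool)) : List (E × Bool) := (l.map stepFlip).reverse

/-- The label of an oriented edge. -/
def stepVal [Group F] (a : E → F) (s : E × Bool) : F := bif s.2 then a s.1 else (a s.1)⁻¹

/-- The product of the labels along a walk, the first step acting first. -/
def walkVal [Group F] (a : E → F) : List (E × Bool) → F
  | [] => 1
  | s :: l => walkVal a l * stepVal a s

/-- An edge is a bridge if its end points are not joined by a walk avoiding the edge. -/
def IsBridgeEdge (src tgt : E → V) (e : E) : Prop :=
  ¬ ∃ l, IsWalk src tgt (tgt e) l (src e) ∧ ∀ s ∈ l, s.1 ≠ e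

/-- A walk all of whose edges are bridges. -/
def IsBridgeWalk (src tgt : E → V) (v : V) (l : List (E × Bool)) (w : V) : Prop :=
  IsWalk src tgt v l w ∧ ∀ s ∈ l, IsBridgeEdge src tgt s.1

/-- Two vertices are joined by a walk of bridges. -/
def BridgeConn (src tgt : E → V) (v w : V) : Prop := ∃ l, IsBridgeWalk src tgt v l w

open Classical in
/-- The label of any bridge walk from `w` to `v`. -/
def transport [Group F] (src tgt : E → V) (a : E → F) (v w : V) : F :=
  if h : BridgeConn src tgt w v then walkVal a h.choose else 1

variable {src tgt : E → V} {v w x : V} {l l' : List (E × Bool)} {s : E × Bool} {e : E}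

@[simp] theorem stepStart_stepFlip : stepStart src tgt (stepFlip s) = stepEnd src tgt s := by
  obtain ⟨e, b⟩ := s; cases b <;> rfl

@[simp] theorem stepEnd_stepFlip : stepEnd src tgt (stepFlip s) = stepStart src tgt s := by
  obtain ⟨e, b⟩ := s; cases b <;> rfl

@[simp] theorem stepFlip_fst : (stepFlip s).1 = s.1 := rfl

@[simp] theorem stepFlip_stepFlip : stepFlip (stepFlip s) = s := by simp [stepFlip]

theorem eq_or_eq_stepFlip {s t : E × Bool} (h : t.1 = s.1) : t = s ∨ t = stepFlip s := by
  obtain ⟨e, b⟩ := s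
  obtain ⟨e', b'⟩ := t
  obtain rfl : e' = e := h
  cases b <;> cases b' <;> simp [stepFlip]

theorem isWalk_append : IsWalk src tgt v (l ++ l') w ↔
    ∃ x, IsWalk src tgt v l x ∧ IsWalk src tgt x l' w := by
  induction l generalizing v with
  | nil => simp [IsWalk]
  | cons s l ih => simp [IsWalk, ih, and_assoc]

theorem IsWalk.reverse (h : IsWalk src tgt v l w) : IsWalk src tgt w (walkReverse l) v := by
  induction l generalizing v with
  | nil => exact h.symm
  | cons s l ih =>
    simp only [walkReverse, List.map_cons, List.reverse_cons]
    exact isWalk_append.2 ⟨_, ih h.2, by simp [IsWalk, h.1]⟩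

theorem forall_mem_walkReverse {p : E → Prop} :
    (∀ s ∈ walkReverse l, p s.1) ↔ ∀ s ∈ l, p s.1 := by
  simp only [walkReverse, List.mem_reverse, List.forall_mem_map, stepFlip_fst]

theorem walkVal_append [Group F] (a : E → F) :
    walkVal a (l ++ l') = walkVal a l' * walkVal a l := by
  induction l with
  | nil => simp [walkVal]
  | cons s l ih => simp [walkVal, ih, mul_assoc]

theorem stepVal_stepFlip [Group F] (a : E → F) : stepVal a (stepFlip s) = (stepVal a s)⁻¹ := by
  obtain ⟨e, b⟩ := s; cases b <;> simp [stepVal, stepFlip]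

theorem walkVal_reverse [Group F] (a : E → F) : walkVal a (walkReverse l) = (walkVal a l)⁻¹ := by
  induction l with
  | nil => simp [walkVal, walkReverse]
  | cons s l ih =>
    rw [walkReverse] at ih
    rw [walkReverse, List.map_cons, List.reverse_cons, walkVal_append, ih]
    simp [walkVal, stepVal_stepFlip]

theorem list_split_first {α : Type*} (p : α → Prop) (l : List α) :
    (∀ x ∈ l, ¬ p x) ∨ ∃ l₁ x l₂, l = l₁ ++ x :: l₂ ∧ p x ∧ ∀ y ∈ l₁, ¬ p y := by
  induction l with
  | nil => simp
  | cons a l ih =>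
    by_cases ha : p a
    · exact .inr ⟨[], a, l, rfl, ha, by simp⟩
    · rcases ih with h | ⟨l₁, x, l₂, rfl, hx, h⟩
      · exact .inl (by simpa [ha] using h)
      · exact .inr ⟨a :: l₁, x, l₂, rfl, hx, by simpa [ha] using h⟩

theorem IsBridgeEdge.not_walk (h : IsBridgeEdge src tgt s.1)
    (hl : IsWalk src tgt (stepEnd src tgt s) l (stepStart src tgt s))
    (hs : ∀ t ∈ l, t.1 ≠ s.1) : False := by
  obtain ⟨e, b⟩ := s
  cases b with
  | true => exact h ⟨l, hl, hs⟩
  | false => exact h ⟨walkReverse l, hl.reverse, forall_mem_walkReverse (p := (· ≠ e)) |>.2 hs⟩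

theorem walkVal_eq_one_of_closed [Group F] (a : E → F) (h : IsBridgeWalk src tgt v l v) :
    walkVal a l = 1 := by
  induction hn : l.length using Nat.strong_induction_on generalizing l v with
  | _ n ih =>
    cases l with
    | nil => rfl
    | cons s l =>
      obtain ⟨⟨h1, h2⟩, h3⟩ := h
      rcases list_split_first (fun t : E × Bool => t.1 = s.1) l with hl | ⟨l₁, t, l₂, rfl, ht, hl⟩
      · exact ((h3 s (by simp)).not_walk (h1 ▸ h2) hl).elim
      · obtain ⟨x, w1, rfl, w2⟩ := isWalk_append.1 h2
        rcases eq_or_eq_stepFlip ht with rfl | rfl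
        · exact ((h3 t (by simp)).not_walk w1 hl).elim
        · simp only [stepStart_stepFlip, stepEnd_stepFlip] at w1 w2
          rw [← h1] at w2
          have e1 := ih l₁.length (by simp at hn; omega) (l := l₁)
            ⟨w1, fun t ht => h3 t (by simp [ht])⟩ rfl
          have e2 := ih l₂.length (by simp at hn; omega) (l := l₂)
            ⟨w2, fun t ht => h3 t (by simp [ht])⟩ rfl
          simp [walkVal, walkVal_append, e1, e2, stepVal_stepFlip]

theorem IsBridgeWalk.nil : IsBridgeWalk src tgt v [] v := ⟨rfl, by simp⟩

theorem IsBridgeWalk.append (h : IsBridgeWalk src tgt v l w) (h' : IsBridgeWalk src tgt w l' x) :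
    IsBridgeWalk src tgt v (l ++ l') x :=
  ⟨isWalk_append.2 ⟨w, h.1, h'.1⟩, fun s hs => (List.mem_append.1 hs).elim (h.2 s) (h'.2 s)⟩

theorem IsBridgeWalk.reverse (h : IsBridgeWalk src tgt v l w) :
    IsBridgeWalk src tgt w (walkReverse l) v :=
  ⟨h.1.reverse, forall_mem_walkReverse.2 h.2⟩

theorem BridgeConn.refl (v : V) : BridgeConn src tgt v v := ⟨_, .nil⟩

theorem BridgeConn.symm : BridgeConn src tgt v w → BridgeConn src tgt w v :=
  fun ⟨_, h⟩ => ⟨_, h.reverse⟩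

theorem BridgeConn.trans : BridgeConn src tgt v w → BridgeConn src tgt w x →
    BridgeConn src tgt v x :=
  fun ⟨_, h⟩ ⟨_, h'⟩ => ⟨_, h.append h'⟩

theorem IsBridgeWalk.transport_eq [Group F] (a : E → F) (h : IsBridgeWalk src tgt w l v) :
    transport src tgt a v w = walkVal a l := by
  have hc : BridgeConn src tgt w v := ⟨l, h⟩
  rw [transport, dif_pos hc]
  have := walkVal_eq_one_of_closed a (hc.choose_spec.append h.reverse)
  rw [walkVal_append, walkVal_reverse] at this
  exact (inv_mul_eq_one.1 this).symm

theorem transport_eq_one [Group F] (a : E → F) (h : ¬ BridgeConn src tgt w v) :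
    transport src tgt a v w = 1 := dif_neg h

theorem transport_mul_transport [Group F] (a : E → F) (h : BridgeConn src tgt v w)
    (h' : BridgeConn src tgt w x) :
    transport src tgt a v w * transport src tgt a w x = transport src tgt a v x := by
  obtain ⟨l, hl⟩ := h.symm
  obtain ⟨l', hl'⟩ := h'.symm
  rw [hl.transport_eq a, hl'.transport_eq a, (hl'.append hl).transport_eq a, walkVal_append]

@[simp] theorem transport_self [Group F] (a : E → F) : transport src tgt a v v = 1 :=
  IsBridgeWalk.nil.transport_eq a

theorem IsBridgeEdge.isBridgeWalk (h : IsBridgeEdge src tgt e) :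
    IsBridgeWalk src tgt (src e) [(e, true)] (tgt e) :=
  ⟨⟨rfl, rfl⟩, by simpa using h⟩

theorem IsBridgeEdge.transport_eq [Group F] (a : E → F) (h : IsBridgeEdge src tgt e) :
    transport src tgt a (tgt e) (src e) = a e := by
  rw [h.isBridgeWalk.transport_eq a]; simp [walkVal, stepVal]

theorem IsWalk.exists_nodup (h : IsWalk src tgt v l w) :
    ∃ l', IsWalk src tgt v l' w ∧ (l'.map Prod.fst).Nodup ∧ l' ⊆ l := by
  induction l generalizing v with
  | nil => exact ⟨[], h, by simp, by simp⟩
  | cons s l ih =>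
    obtain ⟨l', h1, h2, h3⟩ := ih h.2
    rcases list_split_first (fun t : E × Bool => t.1 = s.1) l' with hl | ⟨l₁, t, l₂, rfl, ht, hl⟩
    · refine ⟨s :: l', ⟨h.1, h1⟩, ?_, List.cons_subset_cons s h3⟩
      rw [List.map_cons, List.nodup_cons]
      refine ⟨fun hs => ?_, h2⟩
      obtain ⟨t, ht, hts⟩ := List.mem_map.1 hs
      exact hl t ht hts
    · obtain ⟨x, w1, rfl, w2⟩ := isWalk_append.1 h1
      rw [List.map_append, List.map_cons] at h2
      have hn := h2.of_append_right
      have hsub : t :: l₂ ⊆ l := List.Subset.trans (List.subset_append_right _ _) h3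
      rcases eq_or_eq_stepFlip ht with rfl | rfl
      · exact ⟨t :: l₂, ⟨h.1, w2⟩, hn, fun y hy => List.mem_cons_of_mem _ (hsub hy)⟩
      · rw [stepEnd_stepFlip, ← h.1] at w2
        exact ⟨l₂, w2, (List.nodup_cons.1 hn).2,
          fun y hy => List.mem_cons_of_mem _ (hsub (List.mem_cons_of_mem _ hy))⟩

theorem exists_closed_walk_of_not_isBridgeEdge (h : ¬ IsBridgeEdge src tgt e) :
    ∃ l, IsWalk src tgt (src e) l (src e) ∧ (l.map Prod.fst).Nodup ∧ l ≠ [] := by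
  rw [IsBridgeEdge, not_not] at h
  obtain ⟨l, hl, he⟩ := h
  obtain ⟨l', h1, h2, h3⟩ := hl.exists_nodup
  refine ⟨(e, true) :: l', ⟨rfl, h1⟩, ?_, by simp⟩
  rw [List.map_cons, List.nodup_cons]
  refine ⟨fun hs => ?_, h2⟩
  obtain ⟨t, ht, hts⟩ := List.mem_map.1 hs
  exact he t (h3 ht) hts

section Equivariance

variable {src' tgt' : E → V} {f : V ≃ V} {k : E ≃ E}

theorem isWalk_map (hs : ∀ e, src' (k e) = f (src e)) (ht : ∀ e, tgt' (k e) = f (tgt e)) :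
    IsWalk src' tgt' (f v) (l.map (Prod.map k id)) (f w) ↔ IsWalk src tgt v l w := by
  induction l generalizing v with
  | nil => simp [IsWalk]
  | cons s l ih =>
    have e1 : stepStart src' tgt' (Prod.map k id s) = f (stepStart src tgt s) := by
      obtain ⟨e, b⟩ := s; cases b <;> simp [stepStart, hs, ht]
    have e2 : stepEnd src' tgt' (Prod.map k id s) = f (stepEnd src tgt s) := by
      obtain ⟨e, b⟩ := s; cases b <;> simp [stepEnd, hs, ht]
    simp only [List.map_cons, IsWalk, e1, e2, ih, f.apply_eq_iff_eq]

theorem isBridgeEdge_map (hs : ∀ e, src' (k e) = f (src e)) (ht : ∀ e, tgt' (k e) = f (tgt e)) :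
    IsBridgeEdge src' tgt' (k e) ↔ IsBridgeEdge src tgt e := by
  have hsur : Function.Surjective (List.map (Prod.map k (id : Bool → Bool))) :=
    (Function.Surjective.prodMap k.surjective Function.surjective_id).list_map
  rw [IsBridgeEdge, IsBridgeEdge, hsur.exists]
  simp only [hs, ht, isWalk_map hs ht, List.forall_mem_map, Prod.map_fst, ne_eq, k.apply_eq_iff_eq]

theorem isBridgeWalk_map (hs : ∀ e, src' (k e) = f (src e)) (ht : ∀ e, tgt' (k e) = f (tgt e)) :
    IsBridgeWalk src' tgt' (f v) (l.map (Prod.map k id)) (f w) ↔ IsBridgeWalk src tgt v l w := by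
  simp only [IsBridgeWalk, isWalk_map hs ht, List.forall_mem_map, Prod.map_fst,
    isBridgeEdge_map hs ht]

theorem bridgeConn_map (hs : ∀ e, src' (k e) = f (src e)) (ht : ∀ e, tgt' (k e) = f (tgt e)) :
    BridgeConn src' tgt' (f v) (f w) ↔ BridgeConn src tgt v w := by
  have hsur : Function.Surjective (List.map (Prod.map k (id : Bool → Bool))) :=
    (Function.Surjective.prodMap k.surjective Function.surjective_id).list_map
  rw [BridgeConn, BridgeConn, hsur.exists]
  simp [isBridgeWalk_map hs ht]

theorem transport_map [Group F] {a : E → F} (hs : ∀ e, src' (k e) = f (src e))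
    (ht : ∀ e, tgt' (k e) = f (tgt e)) (ha : ∀ e, a (k e) = a e) :
    transport src' tgt' a (f v) (f w) = transport src tgt a v w := by
  by_cases h : BridgeConn src tgt w v
  · obtain ⟨l, hl⟩ := h
    rw [hl.transport_eq a, ((isBridgeWalk_map hs ht).2 hl).transport_eq a]
    clear hl
    induction l with
    | nil => rfl
    | cons s l ih => simp [walkVal, ih, stepVal, ha]
  · rw [transport_eq_one a h, transport_eq_one a (mt (bridgeConn_map hs ht).1 h)]

end Equivariance

end Walks

section RandomGraph

variable {Γ L B : Type*} [Group Γ]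

/-- The target map of the random graph on `Γ` with seed `ω`: the edge `(g, k)` leads from `g` to
`g * q (ω (g, k))`. -/
def edgeTgt (q : B → Γ) (ω : Γ × L → B) (e : Γ × L) : Γ := e.1 * q (ω e)

/-- The labels of the edges in `T` are prescribed by `τ` and there is an edge-simple walk of length
`n` from `v` to `w` avoiding `T`. -/
def walkEvent (q : B → Γ) (T : Finset (Γ × L)) (τ : Γ × L → Γ) (n : ℕ) (v w : Γ) :
    Set (Γ × L → B) :=
  {ω | (∀ e ∈ T, q (ω e) = τ e) ∧ ∃ l, l.length = n ∧ IsWalk Prod.fst (edgeTgt q ω) v l w ∧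
    (l.map Prod.fst).Nodup ∧ ∀ s ∈ l, s.1 ∉ T}

open Classical in
theorem walkEvent_succ_subset (q : B → Γ) (T : Finset (Γ × L)) (τ : Γ × L → Γ) (n : ℕ) (v w : Γ) :
    walkEvent q T τ (n + 1) v w ⊆ ⋃ x : L × Bool × Γ,
      if (bif x.2.1 then v else v * x.2.2, x.1) ∈ T then ∅ else
      walkEvent q (insert (bif x.2.1 then v else v * x.2.2, x.1) T)
        (Function.update τ (bif x.2.1 then v else v * x.2.2, x.1)
          (bif x.2.1 then x.2.2 else x.2.2⁻¹)) n (v * x.2.2) w := by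
  rintro ω ⟨h1, l, h2, h3, h4, h5⟩
  obtain _ | ⟨⟨⟨g, k⟩, b⟩, l⟩ := l
  · simp at h2
  have h6 : ((g, k) : Γ × L) ∉ T := h5 ((g, k), b) (by simp)
  rw [List.map_cons, List.nodup_cons] at h4
  have main : ∀ t r, q (ω (g, k)) = t → IsWalk Prod.fst (edgeTgt q ω) r l w →
      ω ∈ walkEvent q (insert (g, k) T) (Function.update τ (g, k) t) n r w := by
    intro t r ht hr
    refine ⟨fun e he => ?_, l, by simpa using h2, hr, h4.2, fun s hs hsT => ?_⟩
    · rcases Finset.mem_insert.1 he with rfl | he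
      · simpa using ht
      · rw [Function.update_of_ne (ne_of_mem_of_not_mem he h6), h1 e he]
    · rcases Finset.mem_insert.1 hsT with h | h
      · exact h4.1 (List.mem_map.2 ⟨s, hs, h⟩)
      · exact h5 s (by simp [hs]) h
  rw [mem_iUnion]
  cases b with
  | true =>
    obtain ⟨rfl, h3⟩ := h3
    refine ⟨(k, true, q (ω (v, k))), ?_⟩
    simp only [cond_true] at h6 ⊢
    rw [if_neg h6]
    exact main _ _ rfl h3
  | false =>
    obtain ⟨rfl, h3⟩ := h3
    refine ⟨(k, false, (q (ω (g, k)))⁻¹), ?_⟩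
    simp only [stepStart, cond_false, edgeTgt, mul_inv_cancel_right, inv_inv] at h6 ⊢
    rw [if_neg h6]
    exact main _ _ rfl h3

variable [Countable Γ] [Fintype L] [MeasurableSpace B] {β : Measure B}
  [IsProbabilityMeasure β] {q : B → Γ}
  {m : Γ → ℝ≥0∞}

theorem measure_walkEvent_le (hq : ∀ t, MeasurableSet (q ⁻¹' {t})) (hβ : ∀ t, β (q ⁻¹' {t}) = m t)
    (hm : ∀ g, m g⁻¹ = m g) (n : ℕ) (T : Finset (Γ × L)) (τ : Γ × L → Γ) (v w : Γ) :
    Measure.infinitePi (fun _ : Γ × L => β) (walkEvent q T τ n v w) ≤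
      (∏ e ∈ T, m (τ e)) * ((2 * Fintype.card L : ℝ≥0∞) ^ n * stepDist m n (v⁻¹ * w)) := by
  classical
  induction n generalizing T τ v with
  | zero =>
    by_cases h : v = w
    · subst h
      have : walkEvent q T τ 0 v v ⊆ Set.pi T fun e => q ⁻¹' {τ e} := fun ω h e he => h.1 e he
      refine (measure_mono this).trans ?_
      rw [Measure.infinitePi_pi _ fun _ _ => hq _]
      simp [hβ, stepDist]
    · have : walkEvent q T τ 0 v w = (∅ : Set (Γ × L → B)) := by
        rw [eq_empty_iff_forall_notMem]
        rintro ω ⟨-, l, hl, h3, -⟩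
        rw [List.length_eq_zero_iff.1 hl] at h3
        exact h h3
      simp [this]
  | succ n ih =>
    refine (measure_mono (walkEvent_succ_subset q T τ n v w)).trans ?_
    refine (measure_iUnion_le _).trans ?_
    have hle : ∀ x : L × Bool × Γ, Measure.infinitePi (fun _ : Γ × L => β)
        (if (bif x.2.1 then v else v * x.2.2, x.1) ∈ T then ∅ else
          walkEvent q (insert (bif x.2.1 then v else v * x.2.2, x.1) T)
          (Function.update τ (bif x.2.1 then v else v * x.2.2, x.1)
          (bif x.2.1 then x.2.2 else x.2.2⁻¹)) n (v * x.2.2) w) ≤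
        (∏ e ∈ T, m (τ e)) * (2 * Fintype.card L : ℝ≥0∞) ^ n *
          (m x.2.2 * stepDist m n (x.2.2⁻¹ * (v⁻¹ * w))) := by
      rintro ⟨k, b, t⟩
      split_ifs with hT
      · simp
      · refine (ih _ _ _).trans (le_of_eq ?_)
        rw [Finset.prod_insert hT, Function.update_self, Finset.prod_congr rfl fun e he =>
          congrArg m (Function.update_of_ne (ne_of_mem_of_not_mem he hT) _ _)]
        have : m (bif b then t else t⁻¹) = m t := by cases b <;> simp [hm]
        rw [this, mul_inv_rev, mul_assoc t⁻¹]
        ring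
    refine (ENNReal.tsum_le_tsum hle).trans (le_of_eq ?_)
    rw [ENNReal.tsum_mul_left, ENNReal.tsum_prod']
    simp_rw [ENNReal.tsum_prod']
    have e1 : ∑' t, m t * stepDist m n (t⁻¹ * (v⁻¹ * w)) = stepDist m (n + 1) (v⁻¹ * w) := by
      refine ((Equiv.inv Γ).tsum_eq _).symm.trans (tsum_congr fun t => ?_)
      simp [hm]
    simp only [e1, tsum_fintype, Finset.sum_const, Finset.card_univ, nsmul_eq_mul,
      Fintype.card_bool]
    push_cast
    ring

theorem measure_not_isBridgeEdge_le (hq : ∀ t, MeasurableSet (q ⁻¹' {t}))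
    (hβ : ∀ t, β (q ⁻¹' {t}) = m t) (hm : ∀ g, m g⁻¹ = m g) (k : L) :
    Measure.infinitePi (fun _ : Γ × L => β) {ω | ¬ IsBridgeEdge Prod.fst (edgeTgt q ω) (1, k)} ≤
      ∑' n : ℕ, (2 * Fintype.card L : ℝ≥0∞) ^ (n + 1) * stepDist m (n + 1) 1 := by
  have hsub : {ω : Γ × L → B | ¬ IsBridgeEdge Prod.fst (edgeTgt q ω) (1, k)} ⊆
      ⋃ n : ℕ, walkEvent q ∅ (fun _ => 1) (n + 1) 1 1 := fun ω hω => by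
    obtain ⟨l, h1, h2, h3⟩ := exists_closed_walk_of_not_isBridgeEdge hω
    refine mem_iUnion.2 ⟨l.length - 1, by simp, l, ?_, h1, h2, by simp⟩
    have := List.length_pos_iff.2 h3
    omega
  refine (measure_mono hsub).trans ((measure_iUnion_le _).trans (ENNReal.tsum_le_tsum fun n => ?_))
  simpa using measure_walkEvent_le (L := L) hq hβ hm (n + 1) ∅ (fun _ => 1) 1 1

theorem measure_bridgeConn_le (hq : ∀ t, MeasurableSet (q ⁻¹' {t}))
    (hβ : ∀ t, β (q ⁻¹' {t}) = m t) (hm : ∀ g, m g⁻¹ = m g) (v w : Γ) :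
    Measure.infinitePi (fun _ : Γ × L => β) {ω | BridgeConn Prod.fst (edgeTgt q ω) v w} ≤
      ∑' n : ℕ, (2 * Fintype.card L : ℝ≥0∞) ^ n * stepDist m n (v⁻¹ * w) := by
  have hsub : {ω : Γ × L → B | BridgeConn Prod.fst (edgeTgt q ω) v w} ⊆
      ⋃ n : ℕ, walkEvent q ∅ (fun _ => 1) n v w := fun ω ⟨l, hl⟩ => by
    obtain ⟨l', h1, h2, -⟩ := hl.1.exists_nodup
    exact mem_iUnion.2 ⟨l'.length, by simp, l', rfl, h1, h2, by simp⟩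
  refine (measure_mono hsub).trans ((measure_iUnion_le _).trans (ENNReal.tsum_le_tsum fun n => ?_))
  simpa using measure_walkEvent_le (L := L) hq hβ hm n ∅ (fun _ => 1) v w

end RandomGraph

section Mixing

theorem ENNReal.tendsto_tsum_of_dominated {ι : Type*} {l : Filter ι} [l.IsCountablyGenerated]
    {f : ι → ℕ → ℝ≥0∞} {g bound : ℕ → ℝ≥0∞} (hb : ∑' n, bound n ≠ ∞)
    (hf : ∀ i n, f i n ≤ bound n) (h : ∀ n, Tendsto (fun i => f i n) l (𝓝 (g n))) :
    Tendsto (fun i => ∑' n, f i n) l (𝓝 (∑' n, g n)) := by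
  have := tendsto_lintegral_filter_of_dominated_convergence (l := l) (μ := Measure.count)
    (F := f) (f := g) bound (.of_forall fun i => measurable_of_countable _)
    (.of_forall fun i => .of_forall (hf i)) (by rwa [lintegral_count]) (.of_forall h)
  simpa only [lintegral_count] using this

theorem isCountablyGenerated_cofinite (Γ : Type*) [Countable Γ] :
    (cofinite : Filter Γ).IsCountablyGenerated :=
  HasCountableBasis.isCountablyGenerated ⟨hasBasis_cofinite, Countable.ofPred_finite⟩

/-- A family of maps is mixing along the cofinite filter. -/
def MixingAlong {Γ X : Type*} [MeasurableSpace X] (μ : Measure X) (σ : Γ → X → X) : Prop :=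
  ∀ A A' : Set X, MeasurableSet A → MeasurableSet A' →
    Tendsto (fun γ => μ (A ∩ σ γ ⁻¹' A')) cofinite (𝓝 (μ A * μ A'))

theorem mixingAlong_of_isPiSystem {Γ X : Type*} [Countable Γ] {mX : MeasurableSpace X}
    {μ : Measure X} [IsProbabilityMeasure μ] {σ : Γ → X → X}
    (hσ : ∀ γ, MeasurePreserving (σ γ) μ μ) {C : Set (Set X)}
    (hgen : mX = MeasurableSpace.generateFrom C) (hC : IsPiSystem C)
    (h : ∀ A ∈ C, ∀ A' ∈ C, Tendsto (fun γ => μ (A ∩ σ γ ⁻¹' A')) cofinite (𝓝 (μ A * μ A'))) :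
    MixingAlong μ σ := by
  have := isCountablyGenerated_cofinite Γ
  have hCm : ∀ A ∈ C, MeasurableSet A := fun A hA => by
    rw [hgen]; exact MeasurableSpace.measurableSet_generateFrom hA
  have step1 : ∀ A' ∈ C, ∀ A, MeasurableSet A →
      Tendsto (fun γ => μ (A ∩ σ γ ⁻¹' A')) cofinite (𝓝 (μ A * μ A')) := by
    intro A' hA' A hA
    induction A, hA using MeasurableSpace.induction_on_inter hgen hC with
    | empty => simpa using tendsto_const_nhds
    | basic t ht => exact h t ht A' hA'
    | compl t ht ih =>
      have e : ∀ γ, μ (tᶜ ∩ σ γ ⁻¹' A') = μ A' - μ (t ∩ σ γ ⁻¹' A') := fun γ => by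
        rw [← (hσ γ).measure_preimage (hCm A' hA').nullMeasurableSet,
          ← measure_sdiff inter_subset_right (by
            exact (ht.inter ((hσ γ).measurable (hCm A' hA'))).nullMeasurableSet)
            (measure_ne_top _ _)]
        congr 1
        ext x
        simp only [mem_inter_iff, mem_compl_iff, Set.mem_sdiff]
        tauto
      simp only [e]
      rw [prob_compl_eq_one_sub ht, ENNReal.sub_mul (by simp), one_mul]
      exact ENNReal.Tendsto.sub tendsto_const_nhds ih (.inl (measure_ne_top _ _))
    | iUnion f hd hf ih =>
      have e : ∀ γ, μ ((⋃ n, f n) ∩ σ γ ⁻¹' A') = ∑' n, μ (f n ∩ σ γ ⁻¹' A') := fun γ => by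
        rw [iUnion_inter, measure_iUnion (fun i j hij => (hd hij).mono inter_subset_left
          inter_subset_left) fun n => (hf n).inter ((hσ γ).measurable (hCm A' hA'))]
      simp only [e]
      rw [measure_iUnion hd hf, ← ENNReal.tsum_mul_right]
      refine ENNReal.tendsto_tsum_of_dominated (bound := fun n => μ (f n)) ?_
        (fun γ n => measure_mono inter_subset_left) ih
      rw [← measure_iUnion hd hf]
      exact measure_ne_top _ _
  intro A A' hA hA'
  induction A', hA' using MeasurableSpace.induction_on_inter hgen hC with
  | empty => simpa using tendsto_const_nhds
  | basic t ht => exact step1 t ht A hA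
  | compl t ht ih =>
    have e : ∀ γ, μ (A ∩ σ γ ⁻¹' tᶜ) = μ A - μ (A ∩ σ γ ⁻¹' t) := fun γ => by
      rw [← measure_sdiff inter_subset_left (by
        exact (hA.inter ((hσ γ).measurable ht)).nullMeasurableSet) (measure_ne_top _ _)]
      congr 1
      ext x
      simp only [mem_inter_iff, preimage_compl, mem_compl_iff, Set.mem_sdiff]
      tauto
    simp only [e]
    rw [prob_compl_eq_one_sub ht, ENNReal.mul_sub (by simp), mul_one]
    exact ENNReal.Tendsto.sub tendsto_const_nhds ih (.inl (measure_ne_top _ _))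
  | iUnion f hd hf ih =>
    have e : ∀ γ, μ (A ∩ σ γ ⁻¹' ⋃ n, f n) = ∑' n, μ (A ∩ σ γ ⁻¹' f n) := fun γ => by
      rw [preimage_iUnion, inter_iUnion, measure_iUnion (fun i j hij =>
        ((hd hij).preimage (σ γ)).mono inter_subset_right inter_subset_right)
        fun n => hA.inter ((hσ γ).measurable (hf n))]
    simp only [e]
    rw [measure_iUnion hd hf, ← ENNReal.tsum_mul_left]
    refine ENNReal.tendsto_tsum_of_dominated (bound := fun n => μ (f n)) ?_
      (fun γ n => (measure_mono inter_subset_right).trans_eq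
        ((hσ γ).measure_preimage (hf n).nullMeasurableSet)) ih
    rw [← measure_iUnion hd hf]
    exact measure_ne_top _ _

theorem MixingAlong.prod {Γ X Y : Type*} [Countable Γ] [MeasurableSpace X] [MeasurableSpace Y]
    {μ : Measure X} {ν : Measure Y} [IsProbabilityMeasure μ] [IsProbabilityMeasure ν]
    {σ : Γ → X → X} {τ : Γ → Y → Y} (hσ : ∀ γ, MeasurePreserving (σ γ) μ μ)
    (hτ : ∀ γ, MeasurePreserving (τ γ) ν ν) (h : MixingAlong μ σ) (h' : MixingAlong ν τ) :
    MixingAlong (μ.prod ν) fun γ => Prod.map (σ γ) (τ γ) := by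
  refine mixingAlong_of_isPiSystem (fun γ => (hσ γ).prod (hτ γ)) generateFrom_prod.symm
    isPiSystem_prod ?_
  rintro _ ⟨A, hA, A₂, hA₂, rfl⟩ _ ⟨A', hA', A₂', hA₂', rfl⟩
  have e : ∀ γ, (μ.prod ν) (A ×ˢ A₂ ∩ Prod.map (σ γ) (τ γ) ⁻¹' (A' ×ˢ A₂')) =
      μ (A ∩ σ γ ⁻¹' A') * ν (A₂ ∩ τ γ ⁻¹' A₂') := fun γ => by
    rw [preimage_prod_map_prod, prod_inter_prod, Measure.prod_prod]
  simp only [e, Measure.prod_prod]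
  rw [mul_mul_mul_comm]
  exact ENNReal.Tendsto.mul (h A A' hA hA') (.inr (by finiteness))
    (h' A₂ A₂' hA₂ hA₂') (.inr (by finiteness))

theorem measurePreserving_comp_perm {J B : Type*} [MeasurableSpace B] (β : Measure B)
    [IsProbabilityMeasure β] (e : J ≃ J) :
    MeasurePreserving (fun ω : J → B => ω ∘ e) (Measure.infinitePi fun _ => β)
      (Measure.infinitePi fun _ => β) := by
  refine ⟨measurable_pi_lambda _ fun j => measurable_pi_apply _, ?_⟩
  exact Measure.map_infinitePi_infinitePi_of_inj (P := fun _ : J => β) e.injective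

theorem mixingAlong_bernoulli {Γ J B : Type*} [Countable Γ] [MeasurableSpace B] (β : Measure B)
    [IsProbabilityMeasure β] (e : Γ → J ≃ J) (he : ∀ j j', ∀ᶠ γ in cofinite, e γ j' ≠ j) :
    MixingAlong (Measure.infinitePi fun _ : J => β) fun γ ω => ω ∘ e γ := by
  classical
  refine mixingAlong_of_isPiSystem (fun γ => measurePreserving_comp_perm β (e γ))
    (generateFrom_squareCylinders (α := fun _ : J => B)).symm
    (isPiSystem_squareCylinders (fun _ => MeasurableSpace.isPiSystem_measurableSet) (by simp)) ?_
  rintro _ ⟨F, (t : J → Set B), ht, rfl⟩ _ ⟨F', (t' : J → Set B), ht', rfl⟩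
  have ht : ∀ j, MeasurableSet (t j) := fun j => ht j (mem_univ _)
  have ht' : ∀ j, MeasurableSet (t' j) := fun j => ht' j (mem_univ _)
  have hev : ∀ᶠ γ in cofinite, ∀ j ∈ F, ∀ j' ∈ F', e γ j' ≠ j := by
    simp only [Filter.eventually_all_finset]
    exact fun j _ j' _ => he j j'
  refine Tendsto.congr' ?_ tendsto_const_nhds
  filter_upwards [hev] with γ hγ
  have hdisj : Disjoint F (F'.map (e γ).toEmbedding) := by
    rw [Finset.disjoint_left]
    intro j hj hj'
    obtain ⟨i, hi, rfl⟩ := Finset.mem_map.1 hj'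
    exact hγ _ hj i hi rfl
  have hset : (F : Set J).pi t ∩ (fun ω : J → B => ω ∘ e γ) ⁻¹' (F' : Set J).pi t' =
      ((F ∪ F'.map (e γ).toEmbedding : Finset J) : Set J).pi
        fun j => if j ∈ F then t j else t' ((e γ).symm j) := by
    ext ω
    simp only [mem_inter_iff, Set.mem_pi, mem_preimage, Finset.mem_coe, Finset.mem_union,
      Finset.mem_map, Function.comp]
    constructor
    · rintro ⟨h1, h2⟩ j hj
      split_ifs with hjF
      · exact h1 j hjF
      · obtain ⟨i, hi, rfl⟩ := hj.resolve_left hjF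
        simpa using h2 i hi
    · refine fun h => ⟨fun j hj => by simpa [hj] using h j (.inl hj), fun j hj => ?_⟩
      have hn : e γ j ∉ F := fun hF => hγ _ hF j hj rfl
      simpa [hn] using h (e γ j) (.inr ⟨j, hj, rfl⟩)
  rw [hset, Measure.infinitePi_pi _ fun j _ => ht j, Measure.infinitePi_pi _ fun j _ => ht' j,
    Measure.infinitePi_pi, Finset.prod_union hdisj, Finset.prod_map]
  · congr 1
    · exact Finset.prod_congr rfl fun j hj => by simp [hj]
    · refine Finset.prod_congr rfl fun j hj => ?_
      have hn : e γ j ∉ F := fun hF => hγ _ hF j hj rfl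
      simp [hn]
  · intro j _
    split_ifs
    exacts [ht j, ht' _]

theorem MixingAlong.measure_eq_zero_or {Γ X : Type*} [Infinite Γ] [MeasurableSpace X]
    {μ : Measure X} [IsProbabilityMeasure μ] {σ : Γ → X → X} (h : MixingAlong μ σ) {s : Set X}
    (hs : MeasurableSet s) (hinv : ∀ γ, σ γ ⁻¹' s = s) : μ s = 0 ∨ μ sᶜ = 0 := by
  have h1 := h s s hs hs
  simp only [hinv, inter_self] at h1
  have h2 : μ s = μ s * μ s := tendsto_nhds_unique tendsto_const_nhds h1
  by_cases h0 : μ s = 0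
  · exact .inl h0
  · right
    have h3 : μ s = 1 := by
      have := ENNReal.mul_right_inj h0 (measure_ne_top μ s) (b := μ s) (c := 1)
      exact this.1 (by rw [mul_one, ← h2])
    rwa [prob_compl_eq_zero_iff hs]

end Mixing

section CocycleLaw

theorem measurable_of_countable_cases {ι X Y : Type*} [Countable ι] [MeasurableSpace X]
    [MeasurableSpace Y] {n : X → ι} (hn : ∀ i, MeasurableSet {x | n x = i}) {F : ι → X → Y}
    (hF : ∀ i, Measurable (F i)) : Measurable fun x => F (n x) x := by
  intro s hs
  have : (fun x => F (n x) x) ⁻¹' s = ⋃ i, {x | n x = i} ∩ F i ⁻¹' s := by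
    ext x
    simp only [mem_preimage, mem_iUnion, mem_inter_iff]
    exact ⟨fun h => ⟨n x, rfl, h⟩, fun ⟨i, hi, h⟩ => by rw [show n x = i from hi]; exact h⟩
  rw [this]
  exact .iUnion fun i => (hn i).inter (hF i hs)

variable {Γ Ω Z : Type*} [Group Γ] [MeasurableSpace Ω] [MeasurableSpace Z] {P : Measure Ω}

/-- A measurable field of equivalence relations on `Γ`, equivariant for an action of `Γ`. -/
structure EquivariantRel (S : PmpAction Γ Ω P) where
  conn : Ω → Γ → Γ → Prop
  refl : ∀ ω g, conn ω g g
  symm : ∀ {ω g h}, conn ω g h → conn ω h g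
  trans : ∀ {ω g h k}, conn ω g h → conn ω h k → conn ω g k
  measurableSet_conn : ∀ g h, MeasurableSet {ω | conn ω g h}
  conn_act : ∀ γ ω g h, conn (S.act γ ω) (γ * g) (γ * h) ↔ conn ω g h

variable {S : PmpAction Γ Ω P}

/-- A measurable equivariant cocycle of an equivariant field of equivalence relations, acting on
`Z` by measure-preserving transformations. -/
structure EquivariantCocycle (R : EquivariantRel S) (ζ : Measure Z) where
  coc : Ω → Γ → Γ → Z → Z
  coc_self : ∀ ω g z, coc ω g g z = z
  coc_coc : ∀ {ω g h k}, R.conn ω g h → R.conn ω h k → ∀ z,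
    coc ω g h (coc ω h k z) = coc ω g k z
  measurable_coc : ∀ g h, Measurable fun p : Ω × Z => coc p.1 g h p.2
  measurePreserving_coc : ∀ ω g h, MeasurePreserving (coc ω g h) ζ ζ
  coc_act : ∀ γ ω g h, coc (S.act γ ω) (γ * g) (γ * h) = coc ω g h

/-- A measurable choice of one point in each class. -/
structure EquivariantRel.IsSelector (R : EquivariantRel S) (r : Ω → Γ → Γ) : Prop where
  conn : ∀ ω g, R.conn ω g (r ω g)
  eq_of_conn : ∀ {ω g h}, R.conn ω g h → r ω g = r ω h
  measurable : ∀ g h, MeasurableSet {ω | r ω g = h}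

theorem EquivariantRel.IsSelector.idem {R : EquivariantRel S} {r : Ω → Γ → Γ}
    (hr : R.IsSelector r) (ω : Ω) (g : Γ) : r ω (r ω g) = r ω g :=
  (hr.eq_of_conn (hr.conn ω g)).symm

theorem EquivariantRel.exists_isSelector [Countable Γ] (R : EquivariantRel S) :
    ∃ r, R.IsSelector r := by
  classical
  obtain ⟨f, hf⟩ := exists_injective_nat Γ
  have ne : ∀ ω g, {h | R.conn ω g h}.Nonempty := fun ω g => ⟨g, R.refl ω g⟩
  have key : ∀ ω g h, Function.argminOn f {h | R.conn ω g h} (ne ω g) = h ↔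
      R.conn ω g h ∧ ∀ k, R.conn ω g k → f h ≤ f k := by
    intro ω g h
    have h1 := Function.argminOn_mem f {h | R.conn ω g h} (ne ω g)
    have h2 : ∀ k, R.conn ω g k → f (Function.argminOn f {h | R.conn ω g h} (ne ω g)) ≤ f k :=
      fun k hk => Function.argminOn_le f {h | R.conn ω g h} hk
    constructor
    · rintro rfl
      exact ⟨h1, h2⟩
    · rintro ⟨h3, h4⟩
      exact hf (le_antisymm (h2 _ h3) (h4 _ h1))
  refine ⟨fun ω g => Function.argminOn f {h | R.conn ω g h} (ne ω g), fun ω g => ?_, ?_, ?_⟩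
  · exact ((key ω g _).1 rfl).1
  · intro ω g h hgh
    have : {k | R.conn ω g k} = {k | R.conn ω h k} := by
      ext k
      exact ⟨R.trans (R.symm hgh), R.trans hgh⟩
    simp only [this]
  · intro g h
    simp only [key]
    have : {ω | R.conn ω g h ∧ ∀ k, R.conn ω g k → f h ≤ f k} =
        {ω | R.conn ω g h} ∩ ⋂ k, {ω | R.conn ω g k → f h ≤ f k} := by
      ext
      simp
    rw [this]
    refine (R.measurableSet_conn g h).inter (.iInter fun k => ?_)
    by_cases hk : f h ≤ f k
    · simp [hk]
    · simp only [hk, imp_false]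
      exact (R.measurableSet_conn g k).compl

/-- The translate of a selector. -/
def selectorShift (S : PmpAction Γ Ω P) (γ : Γ) (r : Ω → Γ → Γ) (ω : Ω) (g : Γ) : Γ :=
  γ * r (S.act γ⁻¹ ω) (γ⁻¹ * g)

theorem EquivariantRel.conn_inv_act (R : EquivariantRel S) (γ : Γ) (ω : Ω) (g h : Γ) :
    R.conn (S.act γ⁻¹ ω) (γ⁻¹ * g) h ↔ R.conn ω g (γ * h) := by
  rw [← R.conn_act γ⁻¹ ω g, inv_mul_cancel_left]

theorem EquivariantRel.IsSelector.shift {R : EquivariantRel S} {r : Ω → Γ → Γ}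
    (hr : R.IsSelector r) (γ : Γ) : R.IsSelector (selectorShift S γ r) := by
  refine ⟨fun ω g => ?_, fun {ω g h} hgh => ?_, fun g h => ?_⟩
  · rw [selectorShift, ← R.conn_inv_act]
    exact hr.conn _ _
  · rw [selectorShift, selectorShift, hr.eq_of_conn (h := γ⁻¹ * h)]
    exact (R.conn_act _ _ _ _).2 hgh
  · have : {ω | selectorShift S γ r ω g = h} =
        S.act γ⁻¹ ⁻¹' {ω | r ω (γ⁻¹ * g) = γ⁻¹ * h} := by
      ext ω
      simp [selectorShift, eq_inv_mul_iff_mul_eq]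
    rw [this]
    exact S.measurable _ (hr.measurable _ _)

open Classical in
/-- The selector which agrees with `r` on the classes meeting `F`, and with `r'` elsewhere. -/
def selectorGlue (R : EquivariantRel S) (F : Finset Γ) (r r' : Ω → Γ → Γ) (ω : Ω) (g : Γ) : Γ :=
  if ∃ h ∈ F, R.conn ω g h then r ω g else r' ω g

theorem EquivariantRel.IsSelector.glue {R : EquivariantRel S} {r r' : Ω → Γ → Γ}
    (hr : R.IsSelector r) (hr' : R.IsSelector r') (F : Finset Γ) :
    R.IsSelector (selectorGlue R F r r') := by
  refine ⟨fun ω g => ?_, fun {ω g h} hgh => ?_, fun g h => ?_⟩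
  · unfold selectorGlue
    split_ifs
    exacts [hr.conn _ _, hr'.conn _ _]
  · have : (∃ k ∈ F, R.conn ω g k) ↔ ∃ k ∈ F, R.conn ω h k :=
      exists_congr fun k => and_congr_right fun _ =>
        ⟨R.trans (R.symm hgh), R.trans hgh⟩
    unfold selectorGlue
    rw [hr.eq_of_conn hgh, hr'.eq_of_conn hgh]
    by_cases hk : ∃ k ∈ F, R.conn ω g k
    · rw [if_pos hk, if_pos (this.1 hk)]
    · rw [if_neg hk, if_neg (mt this.2 hk)]
  · have hE : MeasurableSet {ω | ∃ k ∈ F, R.conn ω g k} := by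
      have : {ω | ∃ k ∈ F, R.conn ω g k} = ⋃ k ∈ F, {ω | R.conn ω g k} := by ext; simp
      rw [this]
      exact .biUnion F.countable_toSet fun k _ => R.measurableSet_conn g k
    have : {ω | selectorGlue R F r r' ω g = h} =
        ({ω | ∃ k ∈ F, R.conn ω g k} ∩ {ω | r ω g = h}) ∪
          ({ω | ∃ k ∈ F, R.conn ω g k}ᶜ ∩ {ω | r' ω g = h}) := by
      ext ω
      by_cases hk : ∃ k ∈ F, R.conn ω g k <;> simp [selectorGlue, hk]
    rw [this]
    exact (hE.inter (hr.measurable g h)).union (hE.compl.inter (hr'.measurable g h))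

variable {R : EquivariantRel S} {ζ : Measure Z}

/-- Transport the values at the selected points to all of `Γ`. -/
def spread (C : EquivariantCocycle R ζ) (r : Ω → Γ → Γ) (x : Ω × (Γ → Z)) : Ω × (Γ → Z) :=
  (x.1, fun g => C.coc x.1 g (r x.1 g) (x.2 (r x.1 g)))

theorem measurable_spread [Countable Γ] (C : EquivariantCocycle R ζ) {r : Ω → Γ → Γ}
    (hr : R.IsSelector r) : Measurable (spread C r) := by
  refine measurable_fst.prodMk (measurable_pi_lambda _ fun g => ?_)
  refine measurable_of_countable_cases (n := fun x : Ω × (Γ → Z) => r x.1 g)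
    (F := fun h x => C.coc x.1 g h (x.2 h)) (fun h => measurable_fst (hr.measurable g h))
    fun h => ?_
  exact (C.measurable_coc g h).comp
    (measurable_fst.prodMk ((measurable_pi_apply h).comp measurable_snd))

/-- The involution exchanging two selectors. -/
theorem EquivariantRel.IsSelector.exists_swap {r r' : Ω → Γ → Γ} (hr : R.IsSelector r)
    (hr' : R.IsSelector r') (ω : Ω) :
    ∃ τ : Equiv.Perm Γ, (∀ g, R.conn ω g (τ g)) ∧ ∀ g, τ (r ω g) = r' ω g := by
  classical
  let τ : Γ → Γ := fun h => if h = r ω h then r' ω h else if h = r' ω h then r ω h else h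
  have hconn : ∀ h, R.conn ω h (τ h) := fun h => by
    dsimp only [τ]
    split_ifs
    exacts [hr'.conn _ _, hr.conn _ _, R.refl _ _]
  have hinv : Function.Involutive τ := by
    intro h
    have e1 : r ω (τ h) = r ω h := (hr.eq_of_conn (hconn h)).symm
    have e2 : r' ω (τ h) = r' ω h := (hr'.eq_of_conn (hconn h)).symm
    rw [show τ (τ h) = if τ h = r ω (τ h) then r' ω (τ h) else
      if τ h = r' ω (τ h) then r ω (τ h) else τ h from rfl, e1, e2]
    by_cases h1 : h = r ω h
    · have : τ h = r' ω h := if_pos h1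
      rw [this, if_pos rfl, ← h1]
      split_ifs with h2
      exacts [h2, rfl]
    · by_cases h2 : h = r' ω h
      · have : τ h = r ω h := by dsimp only [τ]; rw [if_neg h1, if_pos h2]
        rw [this, if_pos rfl, ← h2]
      · have : τ h = h := by dsimp only [τ]; rw [if_neg h1, if_neg h2]
        rw [this, if_neg h1, if_neg h2]
  refine ⟨hinv.toPerm, hconn, fun g => ?_⟩
  change τ (r ω g) = _
  dsimp only [τ]
  rw [hr.idem, if_pos rfl]
  exact (hr'.eq_of_conn (hr.conn ω g)).symm

/-- The law of the field spread from the selector `r`. -/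
def spreadLaw (C : EquivariantCocycle R ζ) [IsProbabilityMeasure ζ] (r : Ω → Γ → Γ) :
    Measure (Ω × (Γ → Z)) :=
  (P.prod (Measure.infinitePi fun _ : Γ => ζ)).map (spread C r)

variable [Countable Γ] [IsProbabilityMeasure ζ]

theorem spreadLaw_congr (C : EquivariantCocycle R ζ) {r r' : Ω → Γ → Γ} (hr : R.IsSelector r)
    (hr' : R.IsSelector r') : spreadLaw C r = spreadLaw C r' := by
  ext s hs
  rw [spreadLaw, spreadLaw, Measure.map_apply (measurable_spread C hr) hs,
    Measure.map_apply (measurable_spread C hr') hs,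
    Measure.prod_apply (measurable_spread C hr hs), Measure.prod_apply (measurable_spread C hr' hs)]
  refine lintegral_congr fun ω => ?_
  obtain ⟨τ, hτ, hτr⟩ := hr.exists_swap hr' ω
  let U : (Γ → Z) → Γ → Z := fun u h => C.coc ω h (τ h) (u (τ h))
  have hU : MeasurePreserving U (Measure.infinitePi fun _ : Γ => ζ)
      (Measure.infinitePi fun _ : Γ => ζ) := by
    have h1 := measurePreserving_comp_perm ζ τ
    have h2 : MeasurePreserving (fun (u : Γ → Z) (h : Γ) => C.coc ω h (τ h) (u h))
        (Measure.infinitePi fun _ : Γ => ζ) (Measure.infinitePi fun _ : Γ => ζ) := by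
      have hm := fun h => C.measurePreserving_coc ω h (τ h)
      refine ⟨measurable_pi_lambda _ fun h => (hm h).measurable.comp (measurable_pi_apply h), ?_⟩
      rw [Measure.infinitePi_map_pi (fun _ : Γ => ζ) fun h => (hm h).measurable]
      simp only [(hm _).map_eq]
    exact h2.comp h1
  have hpre : Prod.mk ω ⁻¹' (spread C r' ⁻¹' s) = U ⁻¹' (Prod.mk ω ⁻¹' (spread C r ⁻¹' s)) := by
    ext u
    simp only [mem_preimage]
    have : spread C r (ω, U u) = spread C r' (ω, u) := by
      refine Prod.ext rfl (funext fun g => ?_)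
      simp only [spread, U]
      rw [C.coc_coc (hr.conn ω g) (hτ _), hτr]
    rw [this]
  rw [hpre, hU.measure_preimage]
  exact (measurable_prodMk_left (measurable_spread C hr hs)).nullMeasurableSet

/-- The diagonal action of `Γ` on `Ω × Z^Γ`. -/
def diagShift (S : PmpAction Γ Ω P) (γ : Γ) (x : Ω × (Γ → Z)) : Ω × (Γ → Z) :=
  (S.act γ x.1, fun g => x.2 (γ⁻¹ * g))

omit [Countable Γ] [IsProbabilityMeasure ζ] in
theorem measurable_diagShift (γ : Γ) : Measurable (diagShift (Z := Z) S γ) :=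
  ((S.measurable γ).comp measurable_fst).prodMk
    (measurable_pi_lambda _ fun _ => (measurable_pi_apply _).comp measurable_snd)

variable [IsProbabilityMeasure P]

omit [Countable Γ] in
theorem measurePreserving_diagShift_prod (γ : Γ) :
    MeasurePreserving (diagShift S γ) (P.prod (Measure.infinitePi fun _ : Γ => ζ))
      (P.prod (Measure.infinitePi fun _ : Γ => ζ)) :=
  (S.measurePreserving γ).prod (measurePreserving_comp_perm ζ (Equiv.mulLeft γ⁻¹))

theorem measurePreserving_diagShift (C : EquivariantCocycle R ζ) {r : Ω → Γ → Γ}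
    (hr : R.IsSelector r) (γ : Γ) :
    MeasurePreserving (diagShift S γ) (spreadLaw C r) (spreadLaw C r) := by
  refine ⟨measurable_diagShift γ, ?_⟩
  have h1 : diagShift S γ ∘ spread C r = spread C (selectorShift S γ r) ∘ diagShift S γ := by
    funext x
    have e : S.act γ⁻¹ (S.act γ x.1) = x.1 := by rw [← S.act_mul, inv_mul_cancel, S.act_one]
    refine Prod.ext rfl (funext fun g => ?_)
    simp only [Function.comp, diagShift, spread, selectorShift, e, inv_mul_cancel_left]
    conv_rhs => rw [← mul_inv_cancel_left γ g, C.coc_act]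
    simp
  conv_rhs => rw [spreadLaw_congr C hr (hr.shift γ)]
  rw [spreadLaw, spreadLaw, Measure.map_map (measurable_diagShift γ) (measurable_spread C hr), h1,
    ← Measure.map_map (measurable_spread C (hr.shift γ)) (measurable_diagShift γ),
    (measurePreserving_diagShift_prod γ).map_eq]

theorem isProbabilityMeasure_spreadLaw (C : EquivariantCocycle R ζ) {r : Ω → Γ → Γ}
    (hr : R.IsSelector r) : IsProbabilityMeasure (spreadLaw C r) :=
  Measure.isProbabilityMeasure_map (measurable_spread C hr).aemeasurable

end CocycleLaw

section CocycleMixing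

variable {Γ Ω Z : Type*} [Group Γ] [MeasurableSpace Ω] [MeasurableSpace Z] {P : Measure Ω}
  {S : PmpAction Γ Ω P} {R : EquivariantRel S} {ζ : Measure Z} [Countable Γ]
  [IsProbabilityMeasure ζ] [IsProbabilityMeasure P]

theorem eventually_mul_ne {Γ : Type*} [Group Γ] (g h : Γ) : ∀ᶠ γ in cofinite, γ⁻¹ * g ≠ h := by
  refine (finite_singleton (g * h⁻¹)).compl_mem_cofinite |> Filter.mem_of_superset <| ?_
  rintro γ hγ rfl
  exact hγ (by simp)

theorem mixingAlong_diagShift_prod (hmix : MixingAlong P S.act) :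
    MixingAlong (P.prod (Measure.infinitePi fun _ : Γ => ζ)) (diagShift S) :=
  MixingAlong.prod (σ := S.act) (τ := fun (γ : Γ) (u : Γ → Z) => u ∘ Equiv.mulLeft γ⁻¹)
    S.measurePreserving (fun γ => measurePreserving_comp_perm ζ (Equiv.mulLeft γ⁻¹)) hmix
    (mixingAlong_bernoulli ζ (fun γ : Γ => Equiv.mulLeft γ⁻¹) fun g h => eventually_mul_ne h g)

omit [Countable Γ] [IsProbabilityMeasure ζ] [IsProbabilityMeasure P] in
theorem spread_glue_mem_iff (C : EquivariantCocycle R ζ) {r : Ω → Γ → Γ} (γ : Γ)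
    {F F' : Finset Γ} {A A' : Set Ω} {t t' : Γ → Set Z} {x : Ω × (Γ → Z)}
    (hx : ∀ g ∈ F', ∀ h ∈ F, ¬ R.conn x.1 (γ⁻¹ * g) h) :
    spread C (selectorGlue R F r (selectorShift S γ⁻¹ r)) x ∈
        A ×ˢ (F : Set Γ).pi t ∩ diagShift S γ ⁻¹' (A' ×ˢ (F' : Set Γ).pi t') ↔
      spread C r x ∈ A ×ˢ (F : Set Γ).pi t ∧
        spread C r (diagShift S γ x) ∈ A' ×ˢ (F' : Set Γ).pi t' := by
  obtain ⟨ω, u⟩ := x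
  have e1 : ∀ g ∈ F, selectorGlue R F r (selectorShift S γ⁻¹ r) ω g = r ω g :=
    fun g hg => if_pos ⟨g, hg, R.refl _ _⟩
  have e2 : ∀ g ∈ F', selectorGlue R F r (selectorShift S γ⁻¹ r) ω (γ⁻¹ * g) =
      γ⁻¹ * r (S.act γ ω) g := fun g hg => by
    rw [selectorGlue, if_neg, selectorShift]
    · simp
    · rintro ⟨h, hh, hc⟩
      exact hx g hg h hh hc
  simp only [mem_inter_iff, mem_preimage, mem_prod, spread, diagShift, Set.mem_pi, Finset.mem_coe]
  refine and_congr (and_congr_right fun _ => forall₂_congr fun g hg => ?_)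
    (and_congr_right fun _ => forall₂_congr fun g hg => ?_)
  · rw [e1 g hg]
  · rw [e2 g hg]
    conv_rhs => rw [← mul_inv_cancel_left γ g, ← mul_inv_cancel_left γ (r _ _), C.coc_act]
    simp

theorem mixingAlong_spreadLaw (C : EquivariantCocycle R ζ) {r : Ω → Γ → Γ} (hr : R.IsSelector r)
    (hmix : MixingAlong P S.act)
    (hconn : ∀ g h, Tendsto (fun γ => P {ω | R.conn ω (γ⁻¹ * g) h}) cofinite (𝓝 0)) :
    MixingAlong (spreadLaw C r) (diagShift S) := by
  classical
  have := isProbabilityMeasure_spreadLaw C hr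
  refine mixingAlong_of_isPiSystem (measurePreserving_diagShift C hr)
    (generateFrom_eq_prod (MeasurableSpace.generateFrom_measurableSet (α := Ω))
      (generateFrom_squareCylinders (α := fun _ : Γ => Z)) isCountablySpanning_measurableSet
      ⟨fun _ => univ, fun _ => ⟨∅, fun _ => univ, by simp, by simp⟩, iUnion_const _⟩).symm
    (MeasurableSpace.isPiSystem_measurableSet.prod (isPiSystem_squareCylinders
      (fun _ => MeasurableSpace.isPiSystem_measurableSet) (by simp))) ?_
  rintro _ ⟨A, (hA : MeasurableSet A), _, ⟨F, (t : Γ → Set Z), ht, rfl⟩, rfl⟩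
    _ ⟨A', (hA' : MeasurableSet A'), _, ⟨F', (t' : Γ → Set Z), ht', rfl⟩, rfl⟩
  have hS : MeasurableSet (A ×ˢ (F : Set Γ).pi t) :=
    hA.prod (.pi F.countable_toSet fun j _ => ht j (mem_univ _))
  have hS' : MeasurableSet (A' ×ˢ (F' : Set Γ).pi t') :=
    hA'.prod (.pi F'.countable_toSet fun j _ => ht' j (mem_univ _))
  set s := A ×ˢ (F : Set Γ).pi t
  set s' := A' ×ˢ (F' : Set Γ).pi t'
  have hms := measurable_spread C hr
  let Q := P.prod (Measure.infinitePi fun _ : Γ => ζ)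
  let E : Γ → Set Ω := fun γ => ⋃ g ∈ F', ⋃ h ∈ F, {ω | R.conn ω (γ⁻¹ * g) h}
  have hE : Tendsto (fun γ => P (E γ)) cofinite (𝓝 0) := by
    refine tendsto_of_tendsto_of_tendsto_of_le_of_le tendsto_const_nhds
      (h := fun γ => ∑ g ∈ F', ∑ h ∈ F, P {ω | R.conn ω (γ⁻¹ * g) h}) ?_ (fun _ => zero_le)
      fun γ => ?_
    · rw [show (0 : ℝ≥0∞) = ∑ g ∈ F', ∑ h ∈ F, 0 by simp]
      exact tendsto_finsetSum _ fun g _ => tendsto_finsetSum _ fun h _ => hconn g h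
    · refine (measure_biUnion_finset_le _ _).trans (Finset.sum_le_sum fun g _ => ?_)
      exact measure_biUnion_finset_le _ _
  have hb := mixingAlong_diagShift_prod (ζ := ζ) hmix _ _ (hms hS) (hms hS')
  have hEQ : ∀ γ, Q (Prod.fst ⁻¹' E γ) = P (E γ) := fun γ => by
    have : (Prod.fst ⁻¹' E γ : Set (Ω × (Γ → Z))) = E γ ×ˢ univ := by ext; simp
    rw [this, Measure.prod_prod, measure_univ, mul_one]
  have hagree : ∀ γ x, x.1 ∉ E γ →
      (spread C (selectorGlue R F r (selectorShift S γ⁻¹ r)) x ∈ s ∩ diagShift S γ ⁻¹' s' ↔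
        x ∈ spread C r ⁻¹' s ∩ diagShift S γ ⁻¹' (spread C r ⁻¹' s')) := fun γ x hx =>
    spread_glue_mem_iff C γ fun g hg h hh hc => hx (by
      simp only [E, mem_iUnion]
      exact ⟨g, hg, h, hh, hc⟩)
  have hlaw : ∀ γ, spreadLaw C r (s ∩ diagShift S γ ⁻¹' s') =
      Q (spread C (selectorGlue R F r (selectorShift S γ⁻¹ r)) ⁻¹'
        (s ∩ diagShift S γ ⁻¹' s')) := fun γ => by
    have hr' := hr.glue (hr.shift γ⁻¹) F
    rw [spreadLaw_congr C hr hr', spreadLaw, Measure.map_apply (measurable_spread C hr')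
      (hS.inter (measurable_diagShift γ hS'))]
  have hlim : spreadLaw C r s * spreadLaw C r s' =
      Q (spread C r ⁻¹' s) * Q (spread C r ⁻¹' s') := by
    rw [spreadLaw, Measure.map_apply hms hS, Measure.map_apply hms hS']
  rw [hlim]
  refine tendsto_of_tendsto_of_tendsto_of_le_of_le (g := fun γ =>
      Q (spread C r ⁻¹' s ∩ diagShift S γ ⁻¹' (spread C r ⁻¹' s')) - P (E γ))
    (h := fun γ => Q (spread C r ⁻¹' s ∩ diagShift S γ ⁻¹' (spread C r ⁻¹' s')) + P (E γ))
    ?_ ?_ (fun γ => ?_) fun γ => ?_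
  · simpa using ENNReal.Tendsto.sub hb hE (.inr (by simp))
  · simpa using hb.add hE
  · change _ - _ ≤ spreadLaw C r _
    rw [tsub_le_iff_right, hlaw, ← hEQ]
    refine (measure_mono fun x hx => ?_).trans (measure_union_le _ _)
    by_cases hxE : x.1 ∈ E γ
    · exact .inr hxE
    · exact .inl ((hagree γ x hxE).2 hx)
  · change spreadLaw C r _ ≤ _ + _
    rw [hlaw, ← hEQ]
    refine (measure_mono fun x hx => ?_).trans (measure_union_le _ _)
    by_cases hxE : x.1 ∈ E γ
    · exact .inr hxE
    · exact .inl ((hagree γ x hxE).1 hx)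

end CocycleMixing

section CocycleAction

variable {Γ Ω Z : Type*} [Group Γ] [MeasurableSpace Ω] [MeasurableSpace Z] {P : Measure Ω}
  {S : PmpAction Γ Ω P} {R : EquivariantRel S} {ζ : Measure Z} {r : Ω → Γ → Γ}

/-- The value at each selected point, copied to its whole class. -/
def selectorCopy (r : Ω → Γ → Γ) (x : Ω × (Γ → Z)) : Ω × (Γ → Z) := (x.1, fun g => x.2 (r x.1 g))

/-- The change of coordinates turning copied fields into spread fields. -/
def twist (C : EquivariantCocycle R ζ) (r : Ω → Γ → Γ) (x : Ω × (Γ → Z)) : Ω × (Γ → Z) :=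
  (x.1, fun g => C.coc x.1 g (r x.1 g) (x.2 g))

/-- The inverse of `twist`. -/
def untwist (C : EquivariantCocycle R ζ) (r : Ω → Γ → Γ) (x : Ω × (Γ → Z)) : Ω × (Γ → Z) :=
  (x.1, fun g => C.coc x.1 (r x.1 g) g (x.2 g))

/-- The law of the copied field, on which all the actions below live. -/
def copyLaw (P : Measure Ω) (ζ : Measure Z) [IsProbabilityMeasure ζ] (r : Ω → Γ → Γ) :
    Measure (Ω × (Γ → Z)) :=
  (P.prod (Measure.infinitePi fun _ : Γ => ζ)).map (selectorCopy r)

theorem EquivariantRel.IsSelector.measurable_copy [Countable Γ] (hr : R.IsSelector r) :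
    Measurable (selectorCopy (Z := Z) r) :=
  measurable_fst.prodMk (measurable_pi_lambda _ fun g =>
    measurable_of_countable_cases (n := fun x : Ω × (Γ → Z) => r x.1 g) (F := fun h x => x.2 h)
      (fun h => measurable_fst (hr.measurable g h))
      fun h => (measurable_pi_apply h).comp measurable_snd)

theorem measurable_twist [Countable Γ] (C : EquivariantCocycle R ζ) (hr : R.IsSelector r) :
    Measurable (twist C r) :=
  measurable_fst.prodMk (measurable_pi_lambda _ fun g =>
    measurable_of_countable_cases (n := fun x : Ω × (Γ → Z) => r x.1 g)
      (F := fun h x => C.coc x.1 g h (x.2 g)) (fun h => measurable_fst (hr.measurable g h))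
      fun h => (C.measurable_coc g h).comp
        (measurable_fst.prodMk ((measurable_pi_apply g).comp measurable_snd)))

theorem measurable_untwist [Countable Γ] (C : EquivariantCocycle R ζ) (hr : R.IsSelector r) :
    Measurable (untwist C r) :=
  measurable_fst.prodMk (measurable_pi_lambda _ fun g =>
    measurable_of_countable_cases (n := fun x : Ω × (Γ → Z) => r x.1 g)
      (F := fun h x => C.coc x.1 h g (x.2 g)) (fun h => measurable_fst (hr.measurable g h))
      fun h => (C.measurable_coc h g).comp
        (measurable_fst.prodMk ((measurable_pi_apply g).comp measurable_snd)))

theorem twist_untwist (C : EquivariantCocycle R ζ) (hr : R.IsSelector r) (x : Ω × (Γ → Z)) :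
    twist C r (untwist C r x) = x := by
  refine Prod.ext rfl (funext fun g => ?_)
  have h := hr.conn x.1 g
  simp only [twist, untwist]
  rw [C.coc_coc h (R.symm h), C.coc_self]

theorem untwist_twist (C : EquivariantCocycle R ζ) (hr : R.IsSelector r) (x : Ω × (Γ → Z)) :
    untwist C r (twist C r x) = x := by
  refine Prod.ext rfl (funext fun g => ?_)
  have h := hr.conn x.1 g
  simp only [twist, untwist]
  rw [C.coc_coc (R.symm h) h, C.coc_self]

variable [Countable Γ] [IsProbabilityMeasure ζ]

theorem measurePreserving_twist (C : EquivariantCocycle R ζ) (hr : R.IsSelector r) :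
    MeasurePreserving (twist C r) (copyLaw P ζ r) (spreadLaw C r) :=
  ⟨measurable_twist C hr, by
    rw [copyLaw, Measure.map_map (measurable_twist C hr) hr.measurable_copy]; rfl⟩

theorem measurePreserving_untwist (C : EquivariantCocycle R ζ) (hr : R.IsSelector r) :
    MeasurePreserving (untwist C r) (spreadLaw C r) (copyLaw P ζ r) :=
  ⟨measurable_untwist C hr, by
    rw [← (measurePreserving_twist C hr).map_eq,
      Measure.map_map (measurable_untwist C hr) (measurable_twist C hr)]
    rw [show untwist C r ∘ twist C r = id from funext (untwist_twist C hr), Measure.map_id]⟩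

theorem measurePreserving_fst_copyLaw (hr : R.IsSelector r) :
    MeasurePreserving Prod.fst (copyLaw P ζ r) P :=
  ⟨measurable_fst, by
    rw [copyLaw, Measure.map_map measurable_fst hr.measurable_copy]
    exact measurePreserving_fst.map_eq⟩

theorem nullSingletonClass_copyLaw [MeasurableSingletonClass Ω] [NullSingletonClass P]
    (hr : R.IsSelector r) :
    NullSingletonClass (copyLaw P ζ r) := by
  refine ⟨fun x => measure_mono_null (t := Prod.fst ⁻¹' {x.1}) (by simp) ?_⟩
  rw [(measurePreserving_fst_copyLaw hr).measure_preimage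
    (measurableSet_singleton _).nullMeasurableSet, measure_singleton]

theorem isProbabilityMeasure_copyLaw [IsProbabilityMeasure P] (hr : R.IsSelector r) :
    IsProbabilityMeasure (copyLaw P ζ r) :=
  Measure.isProbabilityMeasure_map hr.measurable_copy.aemeasurable

theorem ae_copyLaw_eq [MeasurableEq Z] (hr : R.IsSelector r) :
    ∀ᵐ x ∂copyLaw P ζ r, ∀ g h, R.conn x.1 g h → x.2 g = x.2 h := by
  have h1 : MeasurableSet {x : Ω × (Γ → Z) | ∀ g h, R.conn x.1 g h → x.2 g = x.2 h} := by
    have : {x : Ω × (Γ → Z) | ∀ g h, R.conn x.1 g h → x.2 g = x.2 h} =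
        ⋂ g, ⋂ h, (Prod.fst ⁻¹' {ω | R.conn ω g h})ᶜ ∪ {x : Ω × (Γ → Z) | x.2 g = x.2 h} := by
      ext x
      simp only [mem_ofPred_eq, mem_iInter, mem_union, mem_compl_iff, mem_preimage]
      exact forall₂_congr fun g h => imp_iff_not_or
    rw [this]
    refine .iInter fun g => .iInter fun h => .union ?_ ?_
    · exact (measurable_fst (R.measurableSet_conn g h)).compl
    · exact measurableSet_eq_fun ((measurable_pi_apply g).comp measurable_snd)
        ((measurable_pi_apply h).comp measurable_snd)
  rw [copyLaw, ae_map_iff hr.measurable_copy.aemeasurable h1]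
  refine .of_forall fun x g h hgh => ?_
  simp only [selectorCopy] at hgh ⊢
  rw [hr.eq_of_conn hgh]

variable [IsProbabilityMeasure P]

/-- The diagonal action on spread fields, in the coordinates of copied fields. -/
def twistedAction (C : EquivariantCocycle R ζ) (hr : R.IsSelector r) :
    PmpAction Γ (Ω × (Γ → Z)) (copyLaw P ζ r) where
  act γ x := untwist C r (diagShift S γ (twist C r x))
  act_one x := by
    rw [show diagShift S 1 (twist C r x) = twist C r x from
      Prod.ext (S.act_one _) (by simp [diagShift]), untwist_twist C hr]
  act_mul g h x := by
    rw [twist_untwist C hr]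
    congr 1
    exact Prod.ext (S.act_mul _ _ _) (by simp [diagShift, mul_assoc])
  measurable γ := (measurable_untwist C hr).comp
    ((measurable_diagShift γ).comp (measurable_twist C hr))
  measurePreserving γ := (measurePreserving_untwist C hr).comp
    ((measurePreserving_diagShift C hr γ).comp (measurePreserving_twist C hr))

theorem twistedAction_fst (C : EquivariantCocycle R ζ) (hr : R.IsSelector r) (γ : Γ)
    (x : Ω × (Γ → Z)) : ((twistedAction C hr).act γ x).1 = S.act γ x.1 := rfl

theorem isFree_twistedAction (C : EquivariantCocycle R ζ) (hr : R.IsSelector r) (hS : S.IsFree) :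
    (twistedAction C hr).IsFree := by
  have := (measurePreserving_fst_copyLaw (ζ := ζ) hr).quasiMeasurePreserving.ae hS
  filter_upwards [this] with x hx g hg
  exact hx g (by rw [← twistedAction_fst C hr, hg])

theorem isErgodic_twistedAction [Infinite Γ] (C : EquivariantCocycle R ζ) (hr : R.IsSelector r)
    (hmix : MixingAlong P S.act)
    (hconn : ∀ g h, Tendsto (fun γ => P {ω | R.conn ω (γ⁻¹ * g) h}) cofinite (𝓝 0)) :
    (twistedAction C hr).IsErgodic := by
  intro s hs hinv
  have := isProbabilityMeasure_spreadLaw C hr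
  have hms := measurable_untwist C hr hs
  have h := (mixingAlong_spreadLaw C hr hmix hconn).measure_eq_zero_or hms fun γ => by
    conv_rhs => rw [← hinv γ]
    ext x
    simp only [mem_preimage, twistedAction, twist_untwist C hr]
  rwa [← preimage_compl, (measurePreserving_untwist C hr).measure_preimage hs.nullMeasurableSet,
    (measurePreserving_untwist C hr).measure_preimage hs.compl.nullMeasurableSet] at h

/-- The value at the identity of the spread field. -/
def valueAtOne (C : EquivariantCocycle R ζ) (r : Ω → Γ → Γ) (x : Ω × (Γ → Z)) : Z :=
  (twist C r x).2 1

omit [Countable Γ] [IsProbabilityMeasure ζ] [IsProbabilityMeasure P] in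
theorem measurable_valueAtOne [Countable Γ] (C : EquivariantCocycle R ζ) (hr : R.IsSelector r) :
    Measurable (valueAtOne C r) :=
  (measurable_pi_apply 1).comp (measurable_snd.comp (measurable_twist C hr))

theorem ae_valueAtOne_act [MeasurableEq Z] (C : EquivariantCocycle R ζ)
    (hr : R.IsSelector r) : ∀ᵐ x ∂copyLaw P ζ r, ∀ t, R.conn x.1 t 1 →
      valueAtOne C r ((twistedAction C hr).act t⁻¹ x) = C.coc x.1 t 1 (valueAtOne C r x) := by
  filter_upwards [ae_copyLaw_eq (P := P) (ζ := ζ) hr] with x hx t ht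
  simp only [valueAtOne, twistedAction, twist_untwist C hr, diagShift, inv_inv, mul_one]
  simp only [twist]
  rw [C.coc_coc ht (hr.conn _ _), hr.eq_of_conn ht, hx t 1 ht]

end CocycleAction

section BridgeRelation

variable {Γ L B : Type*} [Group Γ] [MeasurableSpace B] {β : Measure B}

/-- Translation of the edges of the random graph. -/
def edgeShift (L : Type*) (γ : Γ) : Γ × L ≃ Γ × L := (Equiv.mulLeft γ).prodCongr (Equiv.refl L)

@[simp] theorem edgeShift_apply (γ : Γ) (e : Γ × L) : edgeShift L γ e = (γ * e.1, e.2) := rfl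

/-- The Bernoulli shift on the seeds of the random graph. -/
def seedShift (Γ L : Type*) [Group Γ] (β : Measure B) [IsProbabilityMeasure β] :
    PmpAction Γ (Γ × L → B) (Measure.infinitePi fun _ : Γ × L => β) where
  act γ ω := ω ∘ edgeShift L γ⁻¹
  act_one ω := by ext; simp
  act_mul g h ω := by ext; simp [mul_assoc]
  measurable γ := (measurePreserving_comp_perm β _).measurable
  measurePreserving γ := measurePreserving_comp_perm β _

theorem mixingAlong_seedShift [Countable Γ] [IsProbabilityMeasure β] :
    MixingAlong (Measure.infinitePi fun _ : Γ × L => β) (seedShift Γ L β).act :=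
  mixingAlong_bernoulli β (fun γ : Γ => edgeShift L γ⁻¹) fun e e' =>
    (eventually_mul_ne e'.1 e.1).mono fun _ h h' => h (congrArg Prod.fst h')

theorem map_pair_infinitePi {J : Type*} [IsProbabilityMeasure β] {i j : J} (hij : i ≠ j) :
    (Measure.infinitePi fun _ : J => β).map (fun ω => (ω i, ω j)) = β.prod β := by
  have h1 := ProbabilityTheory.iIndepFun_infinitePi (P := fun _ : J => β)
    (X := fun _ x => x) (fun _ => measurable_id)
  have h2 := h1.indepFun hij
  rw [ProbabilityTheory.indepFun_iff_map_prod_eq_prod_map_map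
    (measurable_pi_apply i).aemeasurable (measurable_pi_apply j).aemeasurable] at h2
  rw [h2]
  congr 1 <;> exact Measure.infinitePi_map_eval _ _

theorem ae_ne_infinitePi {J : Type*} [IsProbabilityMeasure β] [NullSingletonClass β]
    [MeasurableEq B] {i j : J} (hij : i ≠ j) :
    ∀ᵐ ω ∂(Measure.infinitePi fun _ : J => β), ω i ≠ ω j := by
  have h1 : MeasurableSet {p : B × B | p.1 = p.2} :=
    measurableSet_eq_fun measurable_fst measurable_snd
  have h2 : (β.prod β) {p : B × B | p.1 = p.2} = 0 := by
    rw [Measure.prod_apply h1]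
    refine (lintegral_congr fun x => ?_).trans lintegral_zero
    have : Prod.mk x ⁻¹' {p : B × B | p.1 = p.2} = {x} := by
      ext y
      simp [eq_comm]
    rw [this, measure_singleton]
  rw [← map_pair_infinitePi hij, Measure.map_apply ((measurable_pi_apply i).prodMk
    (measurable_pi_apply j)) h1] at h2
  rw [ae_iff]
  simpa using h2

theorem isFree_seedShift [Countable Γ] [Nonempty L] [IsProbabilityMeasure β] [NullSingletonClass β]
    [MeasurableEq B] : (seedShift Γ L β).IsFree := by
  obtain ⟨k⟩ := ‹Nonempty L›
  refine ae_all_iff.2 fun γ => ?_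
  by_cases hγ : γ = 1
  · exact .of_forall fun _ _ => hγ
  · have hne : ((γ⁻¹, k) : Γ × L) ≠ (1, k) := fun h => hγ (by simpa using congrArg Prod.fst h)
    filter_upwards [ae_ne_infinitePi (β := β) hne] with ω hω h
    refine absurd ?_ hω
    have := congrFun h (1, k)
    simpa [seedShift] using this

theorem nullSingletonClass_infinitePi {J : Type*} [Nonempty J] [IsProbabilityMeasure β]
    [NullSingletonClass β] [MeasurableSingletonClass B] :
    NullSingletonClass (Measure.infinitePi fun _ : J => β) := by
  obtain ⟨j⟩ := ‹Nonempty J›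
  refine ⟨fun ω => measure_mono_null (t := (fun ω => ω j) ⁻¹' {ω j}) (by simp) ?_⟩
  rw [← Measure.map_apply (measurable_pi_apply j) (measurableSet_singleton _),
    Measure.infinitePi_map_eval (fun _ : J => β) j, measure_singleton]

variable {q : B → Γ}

theorem measurableSet_edgeTgt (hq : ∀ t, MeasurableSet (q ⁻¹' {t})) (e : Γ × L) (v : Γ) :
    MeasurableSet {ω : Γ × L → B | edgeTgt q ω e = v} := by
  have : {ω : Γ × L → B | edgeTgt q ω e = v} = (fun ω => ω e) ⁻¹' (q ⁻¹' {e.1⁻¹ * v}) := by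
    ext ω
    simp [edgeTgt, eq_inv_mul_iff_mul_eq]
  rw [this]
  exact measurable_pi_apply e (hq _)

theorem measurableSet_isWalk [Countable Γ] (hq : ∀ t, MeasurableSet (q ⁻¹' {t})) (v w : Γ)
    (l : List ((Γ × L) × Bool)) :
    MeasurableSet {ω : Γ × L → B | IsWalk Prod.fst (edgeTgt q ω) v l w} := by
  induction l generalizing v with
  | nil => exact .const _
  | cons s l ih =>
    have h1 : ∀ v, MeasurableSet {ω : Γ × L → B | v = stepStart Prod.fst (edgeTgt q ω) s} := by
      obtain ⟨e, _ | _⟩ := s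
      · simpa [stepStart, eq_comm] using measurableSet_edgeTgt hq e
      · exact fun v => by simp [stepStart]
    have h2 : ∀ v, MeasurableSet {ω : Γ × L → B | stepEnd Prod.fst (edgeTgt q ω) s = v} := by
      obtain ⟨e, _ | _⟩ := s
      · exact fun v => by simp [stepEnd]
      · simpa [stepEnd] using measurableSet_edgeTgt hq e
    have : {ω : Γ × L → B | IsWalk Prod.fst (edgeTgt q ω) v (s :: l) w} =
        {ω | v = stepStart Prod.fst (edgeTgt q ω) s} ∩
          ⋃ u, {ω | stepEnd Prod.fst (edgeTgt q ω) s = u} ∩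
            {ω | IsWalk Prod.fst (edgeTgt q ω) u l w} := by
      ext ω
      simp only [IsWalk, mem_ofPred_eq, mem_inter_iff, mem_iUnion]
      simp
    rw [this]
    exact (h1 v).inter (.iUnion fun u => (h2 u).inter (ih u))

variable [Countable Γ] [Countable L]

theorem measurableSet_isBridgeEdge (hq : ∀ t, MeasurableSet (q ⁻¹' {t})) (e : Γ × L) :
    MeasurableSet {ω : Γ × L → B | IsBridgeEdge Prod.fst (edgeTgt q ω) e} := by
  have : {ω : Γ × L → B | IsBridgeEdge Prod.fst (edgeTgt q ω) e} =
      (⋃ l : {l : List ((Γ × L) × Bool) // ∀ s ∈ l, s.1 ≠ e}, ⋃ u,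
        {ω | edgeTgt q ω e = u} ∩ {ω | IsWalk Prod.fst (edgeTgt q ω) u l.1 e.1})ᶜ := by
    ext ω
    simp only [IsBridgeEdge, mem_ofPred_eq, mem_compl_iff, mem_iUnion, mem_inter_iff,
      Subtype.exists]
    simp [and_comm]
  rw [this]
  exact (MeasurableSet.iUnion fun l => .iUnion fun u =>
    (measurableSet_edgeTgt hq e u).inter (measurableSet_isWalk hq _ _ _)).compl

theorem measurableSet_isBridgeWalk (hq : ∀ t, MeasurableSet (q ⁻¹' {t})) (v w : Γ)
    (l : List ((Γ × L) × Bool)) :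
    MeasurableSet {ω : Γ × L → B | IsBridgeWalk Prod.fst (edgeTgt q ω) v l w} := by
  have : {ω : Γ × L → B | IsBridgeWalk Prod.fst (edgeTgt q ω) v l w} =
      {ω | IsWalk Prod.fst (edgeTgt q ω) v l w} ∩
        ⋂ s ∈ {s | s ∈ l}, {ω | IsBridgeEdge Prod.fst (edgeTgt q ω) s.1} := by
    ext ω
    simp [IsBridgeWalk]
  rw [this]
  exact (measurableSet_isWalk hq _ _ _).inter
    (.biInter (to_countable _) fun s _ => measurableSet_isBridgeEdge hq _)

theorem measurableSet_bridgeConn (hq : ∀ t, MeasurableSet (q ⁻¹' {t})) (v w : Γ) :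
    MeasurableSet {ω : Γ × L → B | BridgeConn Prod.fst (edgeTgt q ω) v w} := by
  have : {ω : Γ × L → B | BridgeConn Prod.fst (edgeTgt q ω) v w} =
      ⋃ l, {ω | IsBridgeWalk Prod.fst (edgeTgt q ω) v l w} := by
    ext ω
    simp [BridgeConn]
  rw [this]
  exact .iUnion fun l => measurableSet_isBridgeWalk hq _ _ _

theorem measurableSet_transport {F : Type*} [Group F] (hq : ∀ t, MeasurableSet (q ⁻¹' {t}))
    (a : Γ × L → F) (v w : Γ) (x : F) :
    MeasurableSet {ω : Γ × L → B | transport Prod.fst (edgeTgt q ω) a v w = x} := by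
  have : {ω : Γ × L → B | transport Prod.fst (edgeTgt q ω) a v w = x} =
      ({ω | BridgeConn Prod.fst (edgeTgt q ω) w v}ᶜ ∩ {_ω | 1 = x}) ∪
        ⋃ l : {l // walkVal a l = x}, {ω | IsBridgeWalk Prod.fst (edgeTgt q ω) w l v} := by
    ext ω
    simp only [mem_ofPred_eq, mem_union, mem_inter_iff, mem_compl_iff, mem_iUnion, Subtype.exists]
    by_cases hc : BridgeConn Prod.fst (edgeTgt q ω) w v
    · obtain ⟨l, hl⟩ := hc
      rw [hl.transport_eq]
      constructor
      · exact fun h => .inr ⟨l, h, hl⟩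
      · rintro (h | ⟨l', h', hl'⟩)
        · exact absurd ⟨l, hl⟩ h.1
        · rw [← hl.transport_eq, hl'.transport_eq, h']
    · rw [transport_eq_one _ hc]
      constructor
      · exact fun h => .inl ⟨hc, h⟩
      · rintro (h | ⟨l', h', hl'⟩)
        · exact h.2
        · exact absurd ⟨l', hl'⟩ hc
  rw [this]
  exact ((measurableSet_bridgeConn hq _ _).compl.inter (.const _)).union
    (.iUnion fun l => measurableSet_isBridgeWalk hq _ _ _)

variable [IsProbabilityMeasure β]

omit [Countable Γ] [Countable L] in
theorem edgeTgt_seedShift (γ : Γ) (ω : Γ × L → B) (e : Γ × L) :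
    edgeTgt q ((seedShift Γ L β).act γ ω) (edgeShift L γ e) = Equiv.mulLeft γ (edgeTgt q ω e) := by
  simp [edgeTgt, seedShift, mul_assoc]

/-- Being joined by a walk of bridges in the random graph. -/
def bridgeRel (hq : ∀ t, MeasurableSet (q ⁻¹' {t})) : EquivariantRel (seedShift Γ L β) where
  conn ω g h := BridgeConn Prod.fst (edgeTgt q ω) g h
  refl _ := .refl
  symm := .symm
  trans := .trans
  measurableSet_conn := measurableSet_bridgeConn hq
  conn_act γ ω _ _ := bridgeConn_map (f := Equiv.mulLeft γ) (k := edgeShift L γ)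
    (fun _ => rfl) (edgeTgt_seedShift γ ω)

/-- The cocycle given by the product of the generators along bridges. -/
def bridgeCocycle {F Z : Type*} [Group F] [Countable F] [MeasurableSpace Z] {ζ : Measure Z}
    (hq : ∀ t, MeasurableSet (q ⁻¹' {t})) (a : L → F) (ρ : F →* Equiv.Perm Z)
    (hρ : ∀ w, MeasurePreserving (ρ w) ζ ζ) :
    EquivariantCocycle (bridgeRel (L := L) (β := β) hq) ζ where
  coc ω g h := ρ (transport Prod.fst (edgeTgt q ω) (fun e => a e.2) g h)
  coc_self _ _ _ := by simp
  coc_coc h h' z := by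
    rw [← transport_mul_transport _ h h', map_mul, Equiv.Perm.mul_apply]
  measurable_coc g h := measurable_of_countable_cases (ι := F)
    (n := fun p : (Γ × L → B) × Z => transport Prod.fst (edgeTgt q p.1) (fun e => a e.2) g h)
    (F := fun w p => ρ w p.2) (fun w => measurable_fst
      (measurableSet_transport hq (fun e : Γ × L => a e.2) g h w))
    fun w => (hρ w).measurable.comp measurable_snd
  measurePreserving_coc _ _ _ := hρ _
  coc_act γ ω g h := by
    have := transport_map (a := fun e : Γ × L => a e.2) (f := Equiv.mulLeft γ) (k := edgeShift L γ)
      (src := Prod.fst) (src' := Prod.fst) (v := g) (w := h)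
      (fun _ => rfl) (edgeTgt_seedShift (q := q) (β := β) γ ω) (fun _ => rfl)
    simp only [Equiv.coe_mulLeft] at this
    rw [this]

end BridgeRelation

section Family

theorem infinite_of_not_isAmenable {Γ : Type*} [Group Γ] (hna : ¬ IsAmenable Γ) : Infinite Γ := by
  by_contra hfin
  rw [not_infinite_iff_finite] at hfin
  have := Fintype.ofFinite Γ
  have hc : (Fintype.card Γ : ℝ) ≠ 0 := by simp
  refine hna (isAmenable_of_almost_invariant fun S c hc0 =>
    ⟨fun _ => (Fintype.card Γ : ℝ)⁻¹, fun _ => by positivity, ?_, fun t _ => by simpa using hc0.le⟩)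
  convert hasSum_fintype (fun _ : Γ => (Fintype.card Γ : ℝ)⁻¹) using 1
  simp [hc]

theorem measure_preimage_cocycle_le {Γ X : Type*} [Group Γ] [Countable Γ] [MeasurableSpace X]
    {μ : Measure X} [IsProbabilityMeasure μ] (A : PmpAction Γ X μ) {c : X → Γ}
    (hc : ∀ g, MeasurableSet (c ⁻¹' {g}))
    (hind : ∀ g h, g ≠ h → μ (A.act g⁻¹ ⁻¹' (c ⁻¹' {g}) ∩ A.act h⁻¹ ⁻¹' (c ⁻¹' {h})) ≤
      μ (c ⁻¹' {g}) * μ (c ⁻¹' {h})) {a : ℝ≥0∞} (ha : a ≠ 0) (ha' : a ≠ ∞) {s : Set X}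
    (hs : MeasurableSet s) : μ {x | A.act (c x) x ∈ s} ≤ a * μ s + 2 / a := by
  classical
  set E : Γ → Set X := fun g => A.act g⁻¹ ⁻¹' (c ⁻¹' {g})
  have hE : ∀ g, MeasurableSet (E g) := fun g => A.measurable _ (hc g)
  have hμE : ∀ g, μ (E g) = μ (c ⁻¹' {g}) := fun g =>
    (A.measurePreserving _).measure_preimage (hc g).nullMeasurableSet
  have hsum : ∑' g, μ (E g) = 1 := by
    simp only [hμE]
    rw [← measure_iUnion (fun g h hgh => ?_) hc]
    · rw [show ⋃ g, c ⁻¹' {g} = univ by ext; simp, measure_univ]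
    · exact Disjoint.preimage _ (by simpa using hgh)
  let N : X → ℝ≥0∞ := fun x => ∑' g, (E g).indicator 1 x
  have hN : Measurable N := Measurable.tsum fun g => measurable_one.indicator (hE g)
  have hN2 : ∫⁻ x, N x * N x ∂μ ≤ 2 := by
    have e1 : ∀ x, N x * N x = ∑' g, ∑' h, (E g ∩ E h).indicator 1 x := fun x => by
      simp only [N]
      rw [← ENNReal.tsum_mul_right]
      refine tsum_congr fun g => ?_
      rw [← ENNReal.tsum_mul_left]
      exact tsum_congr fun h => by rw [inter_indicator_one]; rfl
    simp only [e1]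
    rw [lintegral_tsum fun g => (Measurable.tsum fun h =>
      measurable_one.indicator ((hE g).inter (hE h))).aemeasurable]
    have e2 : ∀ g, ∫⁻ x, ∑' h, (E g ∩ E h).indicator 1 x ∂μ ≤ μ (E g) + μ (E g) := fun g => by
      rw [lintegral_tsum fun h => (measurable_one.indicator ((hE g).inter (hE h))).aemeasurable]
      calc ∑' h, ∫⁻ x, (E g ∩ E h).indicator 1 x ∂μ
          ≤ ∑' h, ((if h = g then μ (E g) else 0) + μ (E g) * μ (E h)) := by
            refine ENNReal.tsum_le_tsum fun h => ?_
            rw [lintegral_indicator_one ((hE g).inter (hE h))]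
            split_ifs with hh
            · exact (measure_mono inter_subset_left).trans le_self_add
            · rw [hμE, hμE, zero_add]
              exact hind g h (Ne.symm hh)
        _ = μ (E g) + μ (E g) := by
            rw [ENNReal.tsum_add, ENNReal.tsum_mul_left, hsum, mul_one, tsum_ite_eq]
    calc ∑' g, ∫⁻ x, ∑' h, (E g ∩ E h).indicator 1 x ∂μ ≤ ∑' g, (μ (E g) + μ (E g)) :=
          ENNReal.tsum_le_tsum e2
      _ = 2 := by rw [ENNReal.tsum_add, hsum, one_add_one_eq_two]
  have hle : ∀ x, N x ≤ a + N x * N x / a := fun x => by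
    rcases le_total (N x) a with h | h
    · exact h.trans le_self_add
    · refine le_trans ?_ le_add_self
      rw [ENNReal.le_div_iff_mul_le (.inl ha) (.inl ha')]
      gcongr
  have hset : {x | A.act (c x) x ∈ s} ⊆ ⋃ g, A.act g ⁻¹' (E g ∩ s) := fun x hx => by
    refine mem_iUnion.2 ⟨c x, ?_, hx⟩
    change c (A.act (c x)⁻¹ (A.act (c x) x)) = c x
    rw [← A.act_mul, inv_mul_cancel, A.act_one]
  calc μ {x | A.act (c x) x ∈ s} ≤ ∑' g, μ (A.act g ⁻¹' (E g ∩ s)) :=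
        (measure_mono hset).trans (measure_iUnion_le _)
    _ = ∑' g, ∫⁻ x in s, (E g).indicator 1 x ∂μ := by
        refine tsum_congr fun g => ?_
        rw [(A.measurePreserving g).measure_preimage ((hE g).inter hs).nullMeasurableSet,
          lintegral_indicator_one (hE g), Measure.restrict_apply (hE g)]
    _ = ∫⁻ x in s, N x ∂μ :=
        (lintegral_tsum fun g => (measurable_one.indicator (hE g)).aemeasurable).symm
    _ ≤ ∫⁻ x in s, (a + N x * N x / a) ∂μ := lintegral_mono hle
    _ = a * μ s + (∫⁻ x in s, N x * N x ∂μ) / a := by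
        simp only [div_eq_mul_inv]
        rw [lintegral_add_left measurable_const, setLIntegral_const,
          lintegral_mul_const _ (show Measurable fun x => N x * N x from hN.mul hN)]
    _ ≤ a * μ s + 2 / a := by
        gcongr
        exact (setLIntegral_le_lintegral _ _).trans hN2

theorem exists_discrete_seed {Γ : Type} [Countable Γ] {m : Γ → ℝ≥0∞} (hm : ∑' g, m g = 1) :
    ∃ (B : Type) (_ : MeasurableSpace B) (_ : StandardBorelSpace B) (β : Measure B)
      (_ : IsProbabilityMeasure β) (_ : NullSingletonClass β) (q : B → Γ),
      (∀ t, MeasurableSet (q ⁻¹' {t})) ∧ ∀ t, β (q ⁻¹' {t}) = m t := by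
  let : MeasurableSpace Γ := ⊤
  have : DiscreteMeasurableSpace Γ := ⟨fun _ => trivial⟩
  let p : PMF Γ := ⟨m, by rw [← hm]; exact ENNReal.summable.hasSum⟩
  have hms : ∀ t : Γ, MeasurableSet (Prod.fst ⁻¹' {t} : Set (Γ × unitInterval)) :=
    fun t => measurable_fst (measurableSet_singleton t)
  refine ⟨Γ × unitInterval, inferInstance, inferInstance, p.toMeasure.prod volume, inferInstance,
    inferInstance, Prod.fst, hms, fun t => ?_⟩
  rw [show (Prod.fst ⁻¹' {t} : Set (Γ × unitInterval)) = {t} ×ˢ univ by ext; simp,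
    Measure.prod_prod, measure_univ, mul_one, PMF.toMeasure_apply_singleton _ _
      (measurableSet_singleton t)]
  rfl

theorem measurePreserving_lift {L Z : Type*} [MeasurableSpace Z] {ζ : Measure Z}
    {T : L → Equiv.Perm Z} (hT : ∀ k, MeasurePreserving (T k) ζ ζ)
    (hT' : ∀ k, MeasurePreserving (T k).symm ζ ζ) (w : FreeGroup L) :
    MeasurePreserving (FreeGroup.lift T w) ζ ζ := by
  induction w using FreeGroup.induction_on with
  | C1 => simpa using MeasurePreserving.id ζ
  | of k => simpa using hT k
  | inv_of k _ => simpa using hT' k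
  | mul v w hv hw => simpa using hv.comp hw

theorem exists_family_of_actions {Γ : Type} [Group Γ] [Countable Γ] (hna : ¬ IsAmenable Γ)
    {L Z ι : Type} [Fintype L] [Nonempty L] [MeasurableSpace Z] [StandardBorelSpace Z]
    (ζ : Measure Z) [IsProbabilityMeasure ζ] (T : ι → L → Equiv.Perm Z)
    (hT : ∀ i k, MeasurePreserving (T i k) ζ ζ) (hT' : ∀ i k, MeasurePreserving (T i k).symm ζ ζ)
    {η : ℝ≥0∞} (hη : 0 < η) :
    ∃ (X : Type) (_ : MeasurableSpace X) (_ : StandardBorelSpace X) (μ : Measure X)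
      (_ : IsProbabilityMeasure μ) (_ : NullSingletonClass μ) (A : ι → PmpAction Γ X μ)
      (c : L → X → Γ) (p : ι → X → Z),
      (∀ i, (A i).IsFree ∧ (A i).IsErgodic) ∧ (∀ k g, MeasurableSet (c k ⁻¹' {g})) ∧
      (∀ i, Measurable (p i)) ∧
      (∀ i k, μ {x | p i ((A i).act (c k x) x) ≠ T i k (p i x)} ≤ η) ∧
      ∀ i k s, MeasurableSet s → ∀ a : ℝ≥0∞, a ≠ 0 → a ≠ ∞ →
        μ {x | (A i).act (c k x) x ∈ s} ≤ a * μ s + 2 / a := by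
  have := infinite_of_not_isAmenable hna
  obtain ⟨m, hm1, hm, hmη, hm0⟩ :=
    exists_rapidly_decaying_walk hna (2 * Fintype.card L : ℝ≥0) hη
  push_cast at hmη hm0
  obtain ⟨B, _, _, β, _, _, q, hq, hβ⟩ := exists_discrete_seed hm1
  let R := bridgeRel (L := L) (β := β) hq
  obtain ⟨r, hr⟩ := R.exists_isSelector
  let C : ι → EquivariantCocycle R ζ := fun i =>
    bridgeCocycle hq FreeGroup.of (FreeGroup.lift (T i))
      (measurePreserving_lift (hT i) (hT' i))
  have hconn : ∀ g h, Tendsto (fun γ : Γ => (Measure.infinitePi fun _ : Γ × L => β)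
      {ω | R.conn ω (γ⁻¹ * g) h}) cofinite (𝓝 0) := fun g h => by
    refine tendsto_of_tendsto_of_tendsto_of_le_of_le tendsto_const_nhds
      (hm0.comp (Function.Injective.tendsto_cofinite (f := fun γ : Γ => g⁻¹ * γ * h)
        fun γ γ' hγ => by simpa using hγ)) (fun _ => zero_le) fun γ => ?_
    refine (measure_bridgeConn_le hq hβ hm _ _).trans_eq ?_
    simp
  have hce : ∀ k g g', (fun x : (Γ × L → B) × (Γ → Z) => (q (x.1 (g', k)))⁻¹) ⁻¹' {g} =
      Prod.fst ⁻¹' ((fun ω : Γ × L → B => ω (g', k)) ⁻¹' (q ⁻¹' {g⁻¹})) := fun k g g' => by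
    ext x
    simp [inv_eq_iff_eq_inv]
  have hcm : ∀ k g,
      MeasurableSet ((fun x : (Γ × L → B) × (Γ → Z) => (q (x.1 (1, k)))⁻¹) ⁻¹' {g}) :=
    fun k g => by
      rw [hce]
      exact (measurable_pi_apply (1, k)).comp measurable_fst (hq _)
  have := isProbabilityMeasure_copyLaw (ζ := ζ) hr
  have := nullSingletonClass_infinitePi (β := β) (J := Γ × L)
  have := nullSingletonClass_copyLaw (ζ := ζ) hr
  refine ⟨(Γ × L → B) × (Γ → Z), inferInstance, inferInstance, copyLaw _ ζ r, inferInstance,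
    inferInstance, fun i => twistedAction (C i) hr, fun k x => (q (x.1 (1, k)))⁻¹,
    fun i => valueAtOne (C i) r, fun i => ⟨isFree_twistedAction _ hr isFree_seedShift,
      isErgodic_twistedAction _ hr mixingAlong_seedShift hconn⟩, fun k g => ?_,
    fun i => measurable_valueAtOne (C i) hr, fun i k => ?_, fun i k s hs a ha ha' => ?_⟩
  · exact hcm k g
  · have hb := measure_not_isBridgeEdge_le hq hβ hm k
    change (Measure.infinitePi fun _ : Γ × L => β)
      {ω | IsBridgeEdge Prod.fst (edgeTgt q ω) (1, k)}ᶜ ≤ _ at hb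
    rw [← (measurePreserving_fst_copyLaw (ζ := ζ) hr).measure_preimage
      (measurableSet_isBridgeEdge hq (1, k)).compl.nullMeasurableSet] at hb
    refine le_trans (measure_mono_ae ?_) (hb.trans hmη)
    filter_upwards [ae_valueAtOne_act (P := Measure.infinitePi fun _ : Γ × L => β) (C i) hr]
      with x hx hne hbr
    refine hne ?_
    have hbr : IsBridgeEdge Prod.fst (edgeTgt q x.1) (1, k) := hbr
    have ht := hbr.transport_eq fun e : Γ × L => FreeGroup.of e.2
    have h1 : R.conn x.1 1 (edgeTgt q x.1 (1, k)) := ⟨_, hbr.isBridgeWalk⟩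
    have htgt : edgeTgt q x.1 (1, k) = q (x.1 (1, k)) := one_mul _
    rw [htgt] at h1 ht
    rw [hx _ (R.symm h1)]
    change FreeGroup.lift (T i) (transport _ _ _ _ _) _ = _
    rw [ht]
    simp
  · refine measure_preimage_cocycle_le (twistedAction (C i) hr) (hcm k) (fun g h hgh => ?_)
      ha ha' hs
    have hact : ∀ g, (twistedAction (C i) hr).act g⁻¹ ⁻¹'
        ((fun x : (Γ × L → B) × (Γ → Z) => (q (x.1 (1, k)))⁻¹) ⁻¹' {g}) =
        Prod.fst ⁻¹' ((fun ω : Γ × L → B => ω (g, k)) ⁻¹' (q ⁻¹' {g⁻¹})) := fun g => by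
      rw [← hce]
      ext x
      have hx : ((twistedAction (C i) hr).act g⁻¹ x).1 (1, k) = x.1 (g, k) := by
        rw [twistedAction_fst]
        simp [seedShift, edgeShift]
      simp only [mem_preimage, hx]
    have hfst := measurePreserving_fst_copyLaw (P := Measure.infinitePi fun _ : Γ × L => β)
      (ζ := ζ) hr
    have hme : ∀ e g, MeasurableSet ((fun ω : Γ × L → B => ω e) ⁻¹' (q ⁻¹' {g})) :=
      fun e g => measurable_pi_apply e (hq g)
    rw [hact, hact, hce, hce, ← preimage_inter,
      hfst.measure_preimage ((hme _ _).inter (hme _ _)).nullMeasurableSet,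
      hfst.measure_preimage (hme _ _).nullMeasurableSet,
      hfst.measure_preimage (hme _ _).nullMeasurableSet]
    have hne : ((g, k) : Γ × L) ≠ (h, k) := fun e => hgh (congrArg Prod.fst e)
    have hev : ∀ e g, (Measure.infinitePi fun _ : Γ × L => β)
        ((fun ω : Γ × L → B => ω e) ⁻¹' (q ⁻¹' {g})) = β (q ⁻¹' {g}) := fun e g => by
      rw [← Measure.map_apply (measurable_pi_apply e) (hq g),
        Measure.infinitePi_map_eval (fun _ : Γ × L => β) e]
    rw [hev, hev, ← Measure.prod_prod, ← map_pair_infinitePi hne, Measure.map_apply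
      ((measurable_pi_apply _).prodMk (measurable_pi_apply _)) ((hq _).prod (hq _))]
    exact le_of_eq rfl

end Family

section Separability

open scoped symmDiff

variable {X C ι : Type*} [MeasurableSpace X]

theorem exists_ne_measure_ne_lt [Countable C] [MeasurableSpace.CountablyGenerated X]
    (μ : Measure X) [IsProbabilityMeasure μ] [Uncountable ι] {φ : ι → X → C}
    (hφ : ∀ i c, MeasurableSet (φ i ⁻¹' {c})) {ε : ℝ} (hε : 0 < ε) :
    ∃ i j, i ≠ j ∧ μ {x | φ i x ≠ φ j x} < ENNReal.ofReal ε := by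
  let _ : MeasurableSpace C := ⊤
  have : DiscreteMeasurableSpace C := ⟨fun _ => trivial⟩
  have hm : ∀ i, Measurable (φ i) := fun i => measurable_to_countable' (hφ i)
  let G : ι → Set (X × C) := fun i => {z | φ i z.1 = z.2}
  have hG : ∀ i, MeasurableSet (G i) := fun i =>
    measurableSet_eq_fun ((hm i).comp measurable_fst) measurable_snd
  let m : Measure (X × C) := μ.prod Measure.count
  have hGm : ∀ i, m (G i) = 1 := fun i => by
    rw [Measure.prod_apply (hG i)]
    have : ∀ x, Measure.count (Prod.mk x ⁻¹' G i) = 1 := fun x => by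
      have : Prod.mk x ⁻¹' G i = {φ i x} := by
        ext c
        simp [G, eq_comm]
      rw [this, Measure.count_singleton]
    simp [this]
  obtain ⟨𝒜, h𝒜, hd⟩ := exists_countable_measureDense m
  choose t ht hlt using fun i => hd.approx (G i) (hG i) (by simp [hGm]) (ε / 2) (by positivity)
  have hninj : ¬ Function.Injective fun i => (⟨t i, ht i⟩ : 𝒜) := fun hinj => by
    have := h𝒜.to_subtype
    exact not_countable (α := ι) hinj.countable
  simp only [Function.Injective, not_forall] at hninj
  obtain ⟨i, j, hij, hne⟩ := hninj
  have hij : t i = t j := congrArg Subtype.val hij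
  refine ⟨i, j, hne, ?_⟩
  have hN : MeasurableSet {x | φ i x ≠ φ j x} := (measurableSet_eq_fun (hm i) (hm j)).compl
  calc μ {x | φ i x ≠ φ j x} ≤ m (G i ∆ G j) := by
        rw [Measure.prod_apply ((hG i).symmDiff (hG j)), ← lintegral_indicator_one hN]
        refine lintegral_mono fun x => ?_
        by_cases hx : φ i x = φ j x
        · simp [hx]
        · have hsub : {φ i x} ⊆ Prod.mk x ⁻¹' (G i ∆ G j) := by
            rintro _ rfl
            exact Or.inl ⟨rfl, fun h => hx (Eq.symm h)⟩
          have := measure_mono (μ := Measure.count) hsub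
          rw [Measure.count_singleton] at this
          simpa [hx] using this
    _ ≤ m (G i ∆ t i) + m (t i ∆ G j) := measure_symmDiff_le _ _ _
    _ < ENNReal.ofReal (ε / 2) + ENNReal.ofReal (ε / 2) := by
        refine ENNReal.add_lt_add (hlt i) ?_
        rw [symmDiff_comm, hij]
        exact hlt j
    _ = ENNReal.ofReal ε := by
        rw [← ENNReal.ofReal_add (by positivity) (by positivity), add_halves]

end Separability

section Labels

/-- The space on which the labels act. -/
abbrev LabelSpace : Type := (ℕ → ZMod 2) × (ℕ → ZMod 2)

/-- The labels: one translation, and `r` shears in each of the two directions. -/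
abbrev ShearLabel (r : ℕ) : Type := Option (Bool × Fin r)

/-- The uniform measure on `ℕ → ZMod 2`. -/
def coinMeasure : Measure (ℕ → ZMod 2) :=
  Measure.infinitePi fun _ => (PMF.uniformOfFintype (ZMod 2)).toMeasure

instance : IsProbabilityMeasure coinMeasure := by
  unfold coinMeasure
  infer_instance

/-- The shift by `k` on sequences. -/
def seqShift (k : ℕ) (x : ℕ → ZMod 2) : ℕ → ZMod 2 := fun n => x (n + k)

theorem measurable_seqShift (k : ℕ) : Measurable (seqShift k) :=
  measurable_pi_lambda _ fun _ => measurable_pi_apply _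

theorem measurePreserving_add_coinMeasure (b : ℕ → ZMod 2) :
    MeasurePreserving (fun x => x + b) coinMeasure coinMeasure := by
  have h1 : ∀ n, (PMF.uniformOfFintype (ZMod 2)).toMeasure.map (fun z => z + b n) =
      (PMF.uniformOfFintype (ZMod 2)).toMeasure := fun n => by
    refine Measure.ext_of_singleton fun z => ?_
    rw [Measure.map_apply (by fun_prop) (measurableSet_singleton _)]
    have : (fun y => y + b n) ⁻¹' {z} = {z - b n} := by
      ext y
      rw [mem_preimage, mem_singleton_iff, mem_singleton_iff, eq_sub_iff_add_eq]
    rw [this, PMF.toMeasure_apply_singleton _ _ (measurableSet_singleton _),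
      PMF.toMeasure_apply_singleton _ _ (measurableSet_singleton _)]
    simp
  refine ⟨measurable_pi_lambda _ fun n => ?_, ?_⟩
  · simp only [Pi.add_apply]
    fun_prop
  · have := Measure.infinitePi_map_pi (fun _ : ℕ => (PMF.uniformOfFintype (ZMod 2)).toMeasure)
      (f := fun n z => z + b n) (fun n => by fun_prop)
    simp only [h1] at this
    exact this

theorem add_add_self_seq (x y : ℕ → ZMod 2) : x + y + y = x := by
  rw [add_assoc, CharTwo.add_self_eq_zero, add_zero]

/-- The part of the action of a label which is linear. -/
def shear {r : ℕ} : ShearLabel r → LabelSpace → LabelSpace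
  | none, z => z
  | some (false, k), z => (z.1, z.2 + seqShift (k + 1) z.1)
  | some (true, k), z => (z.1 + seqShift (k + 1) z.2, z.2)

/-- The translation part of the action of a label. -/
def labelOffset {r : ℕ} (b : LabelSpace) : ShearLabel r → LabelSpace
  | none => b
  | some _ => 0

/-- The action of the labels, whose translation part is given by `b`. -/
def labelPerm {r : ℕ} (b : LabelSpace) (k : ShearLabel r) : Equiv.Perm LabelSpace :=
  Function.Involutive.toPerm (fun z => shear k z + labelOffset b k) <| by
    rintro ⟨x, y⟩
    match k with
    | none => simp [shear, labelOffset, add_assoc, CharTwo.add_self_eq_zero, Prod.ext_iff]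
    | some (false, k) => simp [shear, labelOffset, add_add_self_seq]
    | some (true, k) => simp [shear, labelOffset, add_add_self_seq]

theorem labelPerm_apply {r : ℕ} (b : LabelSpace) (k : ShearLabel r) (z : LabelSpace) :
    labelPerm b k z = shear k z + labelOffset b k := rfl

theorem shear_sub {r : ℕ} (k : ShearLabel r) (z w : LabelSpace) :
    shear k (z - w) = shear k z - shear k w := by
  match k with
  | none => rfl
  | some (false, k) =>
    refine Prod.ext rfl (funext fun n => ?_)
    simp only [shear, seqShift, Prod.snd_sub, Prod.fst_sub, Pi.sub_apply, Pi.add_apply]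
    ring
  | some (true, k) =>
    refine Prod.ext (funext fun n => ?_) rfl
    simp only [shear, seqShift, Prod.snd_sub, Prod.fst_sub, Pi.sub_apply, Pi.add_apply]
    ring

theorem measurePreserving_labelPerm {r : ℕ} (b : LabelSpace) (k : ShearLabel r) :
    MeasurePreserving (labelPerm b k) (coinMeasure.prod coinMeasure)
      (coinMeasure.prod coinMeasure) := by
  have hadd : Measurable fun p : (ℕ → ZMod 2) × (ℕ → ZMod 2) => p.2 + p.1 :=
    measurable_pi_lambda _ fun n => by
      simp only [Pi.add_apply]
      fun_prop
  have hU : ∀ k : ℕ, MeasurePreserving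
      (fun z : LabelSpace => (z.1, z.2 + seqShift k z.1)) (coinMeasure.prod coinMeasure)
      (coinMeasure.prod coinMeasure) := fun k =>
    (MeasurePreserving.id coinMeasure).skew_product (g := fun x y => y + seqShift k x)
      (hadd.comp (((measurable_seqShift k).comp measurable_fst).prodMk measurable_snd))
      (Eventually.of_forall fun x => (measurePreserving_add_coinMeasure (seqShift k x)).map_eq)
  match k with
  | none =>
    exact (measurePreserving_add_coinMeasure b.1).prod (measurePreserving_add_coinMeasure b.2)
  | some (false, k) =>
    convert! hU (k + 1) using 1
    funext z
    simp [labelPerm_apply, shear, labelOffset]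
  | some (true, k) =>
    convert! Measure.measurePreserving_swap.comp
      ((hU (k + 1)).comp Measure.measurePreserving_swap) using 1
    funext z
    simp [labelPerm_apply, shear, labelOffset]

end Labels

section Rigidity

/-- `n` is the first index at which `x` does not vanish. -/
def FirstAt (x : ℕ → ZMod 2) (n : ℕ) : Prop := x n ≠ 0 ∧ ∀ m < n, x m = 0

theorem FirstAt.unique {x : ℕ → ZMod 2} {m n : ℕ} (hm : FirstAt x m) (hn : FirstAt x n) :
    m = n := by
  by_contra hne
  rcases lt_or_gt_of_ne hne with h | h
  · exact hm.1 (hn.2 m h)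
  · exact hn.1 (hm.2 n h)

theorem measurableSet_firstAt (n : ℕ) : MeasurableSet {x : ℕ → ZMod 2 | FirstAt x n} := by
  have : {x : ℕ → ZMod 2 | FirstAt x n} =
      ((fun x : ℕ → ZMod 2 => x n) ⁻¹' {0})ᶜ ∩ ⋂ m : Fin n, (fun x => x m) ⁻¹' {0} := by
    ext x
    simp only [FirstAt, mem_ofPred_eq, mem_inter_iff, mem_compl_iff, mem_preimage,
      mem_singleton_iff, mem_iInter]
    exact and_congr_right fun _ => ⟨fun h m => h m m.2, fun h m hm => h ⟨m, hm⟩⟩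
  rw [this]
  exact (measurable_pi_apply n (measurableSet_singleton _)).compl.inter
    (.iInter fun m : Fin n => measurable_pi_apply (m : ℕ) (measurableSet_singleton _))

/-- The pairs for which the first nonzero index of the first coordinate exceeds that of the
second one by `k`. -/
def firstGap (k : ℕ) : Set LabelSpace := {z | ∃ n, FirstAt z.1 (n + k) ∧ FirstAt z.2 n}

theorem measurableSet_firstGap (k : ℕ) : MeasurableSet (firstGap k) := by
  have : firstGap k = ⋃ n, Prod.fst ⁻¹' {x | FirstAt x (n + k)} ∩
      Prod.snd ⁻¹' {x | FirstAt x n} := by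
    ext z
    simp [firstGap]
  rw [this]
  exact .iUnion fun n => (measurable_fst (measurableSet_firstAt _)).inter
    (measurable_snd (measurableSet_firstAt _))

theorem disjoint_firstGap {k l : ℕ} (h : k ≠ l) : Disjoint (firstGap k) (firstGap l) := by
  rw [Set.disjoint_left]
  rintro z ⟨n, h1, h2⟩ ⟨m, h3, h4⟩
  have e1 := h1.unique h3
  have e2 := h2.unique h4
  omega

/-- Pairs of sequences whose first `r` coordinates vanish. -/
def HeadZero (r : ℕ) (z : LabelSpace) : Prop := ∀ m < r, z.1 m = 0 ∧ z.2 m = 0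

/-- Nonzero pairs with vanishing head, whose first nonzero index is reached by the first
coordinate. -/
def leading (r : ℕ) : Set LabelSpace :=
  {z | HeadZero r z ∧ ∃ n, FirstAt z.1 n ∧ ∀ m < n, z.2 m = 0}

theorem shear_mem_firstGap {r : ℕ} {z : LabelSpace} (hz : z ∈ leading r) (k : Fin r) :
    (z.1, z.2 + seqShift (k + 1) z.1) ∈ firstGap (k + 1) := by
  obtain ⟨h0, n, hn, hn'⟩ := hz
  have hk : (k : ℕ) + 1 ≤ n := by
    by_contra hlt
    exact hn.1 (h0 n (by have := k.2; omega)).1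
  obtain ⟨m, rfl⟩ := Nat.exists_eq_add_of_le' hk
  refine ⟨m, hn, ?_, fun l hl => ?_⟩
  · simpa [seqShift, hn' m (by omega)] using hn.1
  · simp [seqShift, hn' l (by omega), hn.2 (l + (k + 1)) (by omega)]

theorem mem_leading_or_swap {r : ℕ} {z : LabelSpace} (h0 : HeadZero r z) (hz : z ≠ 0) :
    z ∈ leading r ∨ z.swap ∈ leading r := by
  classical
  have hex : ∃ n, z.1 n ≠ 0 ∨ z.2 n ≠ 0 := by
    by_contra hcon
    push Not at hcon
    exact hz (Prod.ext (funext fun n => (hcon n).1) (funext fun n => (hcon n).2))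
  have hmin : ∀ m < Nat.find hex, z.1 m = 0 ∧ z.2 m = 0 := fun m hm => by
    simpa using Nat.find_min hex hm
  rcases Nat.find_spec hex with h | h
  · exact Or.inl ⟨h0, _, ⟨h, fun m hm => (hmin m hm).1⟩, fun m hm => (hmin m hm).2⟩
  · exact Or.inr ⟨fun m hm => (h0 m hm).symm, _, ⟨h, fun m hm => (hmin m hm).2⟩,
      fun m hm => (hmin m hm).1⟩

variable {X : Type*} [MeasurableSpace X] {μ : Measure X} [IsProbabilityMeasure μ]

theorem measureReal_le_of_packing {r : ℕ} (hr : 0 < r) {P : Set X} {B bad : Fin r → Set X}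
    {θ : Fin r → X → X} {a e : ℝ} (ha : 0 < a) (hB : ∀ k, MeasurableSet (B k))
    (hd : Pairwise (Function.onFun Disjoint B)) (hbad : ∀ k, μ.real (bad k) ≤ e)
    (hθ : ∀ k, μ.real (θ k ⁻¹' B k) ≤ a * μ.real (B k) + 2 / a)
    (hP : ∀ k, P ⊆ bad k ∪ θ k ⁻¹' B k) :
    μ.real P ≤ e + a / r + 2 / a := by
  have h1 : ∀ k, μ.real P ≤ e + (a * μ.real (B k) + 2 / a) := fun k =>
    ((measureReal_mono (hP k)).trans (measureReal_union_le _ _)).trans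
      (add_le_add (hbad k) (hθ k))
  have h2 : ∑ k, μ.real (B k) ≤ 1 := by
    rw [← measureReal_iUnion_fintype hd hB]
    exact measureReal_le_one
  have h3 := Finset.sum_le_sum fun (k : Fin r) (_ : k ∈ Finset.univ) => h1 k
  simp only [Finset.sum_add_distrib, ← Finset.mul_sum, Finset.sum_const, Finset.card_univ,
    Fintype.card_fin, nsmul_eq_mul] at h3
  have hr' : (0 : ℝ) < r := by exact_mod_cast hr
  have h4 : r * μ.real P ≤ r * (e + a / r + 2 / a) := by
    have : (r : ℝ) * (e + a / r + 2 / a) = r * e + (a + r * (2 / a)) := by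
      field_simp
      ring
    rw [this]
    nlinarith
  exact le_of_mul_le_mul_left h4 hr'

theorem false_of_almost_equivariant {r : ℕ} (hr : r = 160000) {D : X → LabelSpace}
    (hD : Measurable D) {θ : ShearLabel r → X → X} {δ : LabelSpace} (hδ : δ ≠ 0)
    (hθ : ∀ k s, MeasurableSet s → ∀ a : ℝ, 0 < a →
      μ.real (θ k ⁻¹' s) ≤ a * μ.real s + 2 / a)
    (hbad : ∀ k, μ.real {x | D (θ k x) ≠ shear k (D x) + labelOffset δ k} ≤ 1 / 100)
    (hhead : μ.real {x | ¬ HeadZero r (D x)} ≤ 1 / 100) : False := by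
  have hr0 : 0 < r := by omega
  have hr' : (r : ℝ) = 160000 := by rw [hr]; norm_num
  have h1 : μ.real (D ⁻¹' leading r) ≤ 1 / 100 + 400 / r + 2 / 400 := by
    refine measureReal_le_of_packing hr0 (θ := fun k => θ (some (false, k)))
      (B := fun k => D ⁻¹' firstGap (k + 1)) (by norm_num)
      (fun k => hD (measurableSet_firstGap _))
      (fun k l hkl => (disjoint_firstGap fun h => hkl (Fin.ext (by omega))).preimage D)
      (fun k => hbad (some (false, k)))
      (fun k => hθ _ _ (hD (measurableSet_firstGap _)) _ (by norm_num)) fun k x hx => ?_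
    by_cases h : D (θ (some (false, k)) x) =
        shear (some (false, k)) (D x) + labelOffset δ (some (false, k))
    · refine Or.inr ?_
      rw [mem_preimage, mem_preimage, h]
      simpa [labelOffset, shear] using shear_mem_firstGap hx k
    · exact Or.inl h
  have h2 : μ.real (D ⁻¹' (Prod.swap ⁻¹' leading r)) ≤ 1 / 100 + 400 / r + 2 / 400 := by
    refine measureReal_le_of_packing hr0 (θ := fun k => θ (some (true, k)))
      (B := fun k => D ⁻¹' (Prod.swap ⁻¹' firstGap (k + 1))) (by norm_num)
      (fun k => hD (measurable_swap (measurableSet_firstGap _)))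
      (fun k l hkl => ((disjoint_firstGap fun h => hkl (Fin.ext (by omega))).preimage _).preimage D)
      (fun k => hbad (some (true, k)))
      (fun k => hθ _ _ (hD (measurable_swap (measurableSet_firstGap _))) _ (by norm_num))
      fun k x hx => ?_
    by_cases h : D (θ (some (true, k)) x) =
        shear (some (true, k)) (D x) + labelOffset δ (some (true, k))
    · refine Or.inr ?_
      rw [mem_preimage, mem_preimage, mem_preimage, h]
      simpa [labelOffset, shear] using shear_mem_firstGap hx k
    · exact Or.inl h
  have hne : μ.real (D ⁻¹' {0}ᶜ) ≤ 1 / 100 +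
      (μ.real (D ⁻¹' leading r) + μ.real (D ⁻¹' (Prod.swap ⁻¹' leading r))) := by
    refine le_trans (measureReal_mono (s₂ := {x | ¬ HeadZero r (D x)} ∪
      (D ⁻¹' leading r ∪ D ⁻¹' (Prod.swap ⁻¹' leading r))) fun x hx => ?_)
      ((measureReal_union_le _ _).trans (add_le_add hhead (measureReal_union_le _ _)))
    by_cases h : HeadZero r (D x)
    · exact Or.inr (mem_leading_or_swap h hx)
    · exact Or.inl h
  have hone : (1 : ℝ) ≤ 1 / 100 + (μ.real (D ⁻¹' {0}ᶜ) +
      (10 * μ.real (D ⁻¹' {0}ᶜ) + 2 / 10)) := by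
    refine (probReal_univ (μ := μ)).ge.trans ?_
    refine le_trans (measureReal_mono (s₂ := {x | D (θ none x) ≠ shear none (D x) +
      labelOffset δ none} ∪ (D ⁻¹' {0}ᶜ ∪ θ none ⁻¹' (D ⁻¹' {0}ᶜ))) fun x _ => ?_)
      ((measureReal_union_le _ _).trans (add_le_add (hbad none)
        ((measureReal_union_le _ _).trans (add_le_add le_rfl
          (hθ none _ (hD (measurableSet_singleton _).compl) 10 (by norm_num))))))
    by_cases h : D (θ none x) = shear (none : ShearLabel r) (D x) +
        labelOffset δ (none : ShearLabel r)
    · by_cases h0 : D x = 0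
      · refine Or.inr (Or.inr ?_)
        rw [mem_preimage, mem_preimage, h, h0]
        simpa [shear, labelOffset] using hδ
      · exact Or.inr (Or.inl h0)
    · exact Or.inl h
  rw [hr'] at h1 h2
  norm_num at *
  linarith

end Rigidity

section Countability

variable {Γ X : Type*} [Group Γ] [MeasurableSpace X] {μ : Measure X}

theorem measurable_act_cocycle [Countable Γ] (A : PmpAction Γ X μ) {c : X → Γ}
    (hc : ∀ g, MeasurableSet (c ⁻¹' {g})) : Measurable fun x => A.act (c x) x :=
  measurable_of_countable_cases (n := c) (F := A.act) hc A.measurable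

theorem exists_measurable_cocycle [Countable Γ] [MeasurableEq X] (B : PmpAction Γ X μ)
    {σ : X → X} (hσ : Measurable σ) (h : ∀ᵐ y ∂μ, ∃ g, σ y = B.act g y) :
    ∃ c : X → Γ, (∀ g, MeasurableSet (c ⁻¹' {g})) ∧ ∀ᵐ y ∂μ, σ y = B.act (c y) y := by
  classical
  obtain ⟨f, hf⟩ := exists_surjective_nat Γ
  have hE : ∀ n, MeasurableSet {y | σ y = B.act (f n) y} := fun n =>
    measurableSet_eq_fun hσ (B.measurable _)
  have hex : ∀ y, ∃ n, σ y = B.act (f n) y ∨ ∀ m, σ y ≠ B.act (f m) y := fun y => by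
    by_cases hy : ∃ n, σ y = B.act (f n) y
    · exact hy.imp fun _ => Or.inl
    · exact ⟨0, Or.inr fun m hm => hy ⟨m, hm⟩⟩
  have hN : Measurable fun y => Nat.find (hex y) := by
    refine measurable_find hex fun n => ?_
    have : {y | σ y = B.act (f n) y ∨ ∀ m, σ y ≠ B.act (f m) y} =
        {y | σ y = B.act (f n) y} ∪ ⋂ m, {y | σ y = B.act (f m) y}ᶜ := by
      ext y
      simp
    rw [this]
    exact (hE n).union (.iInter fun m => (hE m).compl)
  refine ⟨fun y => f (Nat.find (hex y)), fun g => hN (f ⁻¹' {g}).to_countable.measurableSet, ?_⟩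
  filter_upwards [h] with y ⟨g, hg⟩
  obtain ⟨n, rfl⟩ := hf g
  exact (Nat.find_spec (hex y)).resolve_right fun hy => hy n hg

theorem ae_exists_act_eq {A B : PmpAction Γ X μ} {Δ : X ≃ᵐ X} (hΔ : MeasurePreserving Δ μ μ)
    (hAB : ∀ᵐ x ∂μ, Δ '' A.orbit x = B.orbit (Δ x)) (c : X → Γ) :
    ∀ᵐ y ∂μ, ∃ g, Δ (A.act (c (Δ.symm y)) (Δ.symm y)) = B.act g y := by
  have := (hΔ.symm Δ).quasiMeasurePreserving.ae hAB
  filter_upwards [this] with y hy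
  have h1 : Δ (A.act (c (Δ.symm y)) (Δ.symm y)) ∈ Δ '' A.orbit (Δ.symm y) :=
    mem_image_of_mem _ ⟨_, rfl⟩
  rw [hy, Δ.apply_symm_apply] at h1
  exact h1

theorem measureReal_preimage_act_le [IsProbabilityMeasure μ] {θ : X → X} {s : Set X}
    (h : ∀ a : ℝ≥0∞, a ≠ 0 → a ≠ ∞ → μ (θ ⁻¹' s) ≤ a * μ s + 2 / a) {a : ℝ} (ha : 0 < a) :
    μ.real (θ ⁻¹' s) ≤ a * μ.real s + 2 / a := by
  have h1 := h (ENNReal.ofReal a) (by simpa using ha) ENNReal.ofReal_ne_top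
  rw [← ENNReal.ofReal_toReal (measure_ne_top μ s), ← ENNReal.ofReal_mul ha.le,
    ← ENNReal.ofReal_ofNat, ← ENNReal.ofReal_div_of_pos ha, ← ENNReal.ofReal_add
      (mul_nonneg ha.le ENNReal.toReal_nonneg) (by positivity)] at h1
  exact ENNReal.toReal_le_of_le_ofReal
    (add_nonneg (mul_nonneg ha.le ENNReal.toReal_nonneg) (by positivity)) h1

theorem false_of_close_codes [Countable Γ] [IsProbabilityMeasure μ] {r : ℕ} (hr : r = 160000)
    {A A' B : PmpAction Γ X μ} {c : ShearLabel r → X → Γ} {p p' : X → LabelSpace}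
    (hp : Measurable p) (hp' : Measurable p') {b b' : LabelSpace} (hb : b ≠ b')
    (hA : ∀ k, μ {x | p (A.act (c k x) x) ≠ labelPerm b k (p x)} ≤ ENNReal.ofReal (3 / 1000))
    (hA' : ∀ k, μ {x | p' (A'.act (c k x) x) ≠ labelPerm b' k (p' x)} ≤ ENNReal.ofReal (3 / 1000))
    (hθ : ∀ k s, MeasurableSet s → ∀ a : ℝ≥0∞, a ≠ 0 → a ≠ ∞ →
      μ {x | A.act (c k x) x ∈ s} ≤ a * μ s + 2 / a)
    {Δ Δ' : X ≃ᵐ X} (hΔ : MeasurePreserving Δ μ μ) (hΔ' : MeasurePreserving Δ' μ μ)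
    {d d' : ShearLabel r → X → Γ}
    (hd : ∀ k, ∀ᵐ y ∂μ, Δ (A.act (c k (Δ.symm y)) (Δ.symm y)) = B.act (d k y) y)
    (hd' : ∀ k, ∀ᵐ y ∂μ, Δ' (A'.act (c k (Δ'.symm y)) (Δ'.symm y)) = B.act (d' k y) y)
    (hclose : μ {y | ¬ (HeadZero r (p (Δ.symm y) - p' (Δ'.symm y)) ∧ ∀ k, d k y = d' k y)} ≤
      ENNReal.ofReal (3 / 1000)) : False := by
  let Ψ : X ≃ᵐ X := Δ.trans Δ'.symm
  have hΨ : MeasurePreserving Ψ μ μ := (hΔ'.symm Δ').comp hΔ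
  have hΨx : ∀ x, Δ'.symm (Δ x) = Ψ x := fun x => rfl
  have hclose' : μ {x | ¬ (HeadZero r (p x - p' (Ψ x)) ∧ ∀ k, d k (Δ x) = d' k (Δ x))} ≤
      ENNReal.ofReal (3 / 1000) := by
    rw [← hΔ.measure_preimage_equiv] at hclose
    refine le_of_eq_of_le (congrArg μ ?_) hclose
    ext x
    change _ ↔ ¬ (HeadZero r (p (Δ.symm (Δ x)) - p' (Ψ x)) ∧ ∀ k, d k (Δ x) = d' k (Δ x))
    rw [Δ.symm_apply_apply]
    rfl
  have hsub : Measurable fun z : LabelSpace × LabelSpace => z.1 - z.2 := by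
    refine .prodMk (measurable_pi_lambda _ fun n => ?_) (measurable_pi_lambda _ fun n => ?_)
    · simp only [Pi.sub_apply]
      fun_prop
    · simp only [Pi.sub_apply]
      fun_prop
  refine false_of_almost_equivariant (μ := μ) hr (D := fun x => p x - p' (Ψ x))
    (hsub.comp (hp.prodMk (hp'.comp Ψ.measurable))) (θ := fun k x => A.act (c k x) x)
    (sub_ne_zero.2 hb) (fun k s hs a ha => measureReal_preimage_act_le (hθ k s hs) ha)
    (fun k => ?_) ?_
  · refine ENNReal.toReal_le_of_le_ofReal (by norm_num) ?_
    have h2 := hA' k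
    rw [← hΨ.measure_preimage_equiv] at h2
    refine (measure_mono_ae (t := {x | p (A.act (c k x) x) ≠ labelPerm b k (p x)} ∪
      (Ψ ⁻¹' {x | p' (A'.act (c k x) x) ≠ labelPerm b' k (p' x)} ∪
      {x | ¬ (HeadZero r (p x - p' (Ψ x)) ∧ ∀ k, d k (Δ x) = d' k (Δ x))})) ?_).trans
      (((measure_union_le _ _).trans (add_le_add (hA k) ((measure_union_le _ _).trans
        (add_le_add h2 hclose')))).trans ?_)
    · filter_upwards [hΔ.quasiMeasurePreserving.ae (hd k),
        hΔ.quasiMeasurePreserving.ae (hd' k)] with x h3 h4 hx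
      by_contra hcon
      change ¬ (p (A.act (c k x) x) ≠ labelPerm b k (p x) ∨
        p' (A'.act (c k (Ψ x)) (Ψ x)) ≠ labelPerm b' k (p' (Ψ x)) ∨
        ¬ (HeadZero r (p x - p' (Ψ x)) ∧ ∀ k, d k (Δ x) = d' k (Δ x))) at hcon
      simp only [not_or, not_not] at hcon
      obtain ⟨h5, h6, -, h7⟩ := hcon
      refine hx ?_
      rw [Δ.symm_apply_apply] at h3
      rw [hΨx, ← h7 k, ← h3] at h4
      have h8 : Ψ (A.act (c k x) x) = A'.act (c k (Ψ x)) (Ψ x) := by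
        rw [← hΨx, ← h4, Δ'.symm_apply_apply]
      change p (A.act (c k x) x) - p' (Ψ (A.act (c k x) x)) = _
      rw [h8, h5, h6, labelPerm_apply, labelPerm_apply, shear_sub]
      match k with
      | none => simp only [labelOffset]; abel
      | some _ => simp only [labelOffset]; abel
    · rw [← ENNReal.ofReal_add (by norm_num) (by norm_num),
        ← ENNReal.ofReal_add (by norm_num) (by norm_num)]
      exact ENNReal.ofReal_le_ofReal (by norm_num)
  · refine ENNReal.toReal_le_of_le_ofReal (by norm_num) ?_
    refine (measure_mono fun x hx => ?_).trans (hclose'.trans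
      (ENNReal.ofReal_le_ofReal (by norm_num)))
    exact fun h => hx h.1

theorem countable_setOf_orbitEquivalent [Countable Γ] [StandardBorelSpace X]
    [IsProbabilityMeasure μ] {r : ℕ} (hr : r = 160000) {ι : Type*}
    {A : ι → PmpAction Γ X μ} {c : ShearLabel r → X → Γ} {p : ι → X → LabelSpace}
    {b : ι → LabelSpace} (hb : Function.Injective b)
    (hc : ∀ k g, MeasurableSet (c k ⁻¹' {g})) (hp : ∀ i, Measurable (p i))
    (hA : ∀ i k, μ {x | p i ((A i).act (c k x) x) ≠ labelPerm (b i) k (p i x)} ≤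
      ENNReal.ofReal (3 / 1000))
    (hθ : ∀ i k s, MeasurableSet s → ∀ a : ℝ≥0∞, a ≠ 0 → a ≠ ∞ →
      μ {x | (A i).act (c k x) x ∈ s} ≤ a * μ s + 2 / a)
    (B : PmpAction Γ X μ) : {i | OrbitEquivalent (A i) B}.Countable := by
  by_contra hcount
  have : Uncountable {i | OrbitEquivalent (A i) B} :=
    not_countable_iff.1 fun h => hcount h
  have hΔ : ∀ i : {i | OrbitEquivalent (A i) B}, ∃ Δ : X ≃ᵐ X, MeasurePreserving Δ μ μ ∧
      ∀ᵐ x ∂μ, Δ '' (A i).orbit x = B.orbit (Δ x) := fun i => by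
    obtain ⟨Δ, h1, h2, h3, h4⟩ := i.2
    exact ⟨⟨Δ, h1, h2⟩, h3, h4⟩
  choose Δ hΔ hO using hΔ
  have hcoc := fun (i : {i | OrbitEquivalent (A i) B}) k => exists_measurable_cocycle B
    ((Δ i).measurable.comp ((measurable_act_cocycle (A i) (hc k)).comp (Δ i).symm.measurable))
    (ae_exists_act_eq (hΔ i) (hO i) (c k))
  choose d hdm hd using hcoc
  let φ : {i | OrbitEquivalent (A i) B} → X →
      ((Fin r → ZMod 2) × (Fin r → ZMod 2)) × (ShearLabel r → Γ) := fun i y =>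
    ((fun m => (p i ((Δ i).symm y)).1 m, fun m => (p i ((Δ i).symm y)).2 m), fun k => d i k y)
  have hφ : ∀ i e, MeasurableSet (φ i ⁻¹' {e}) := fun i e => by
    have he : φ i ⁻¹' {e} = ((⋂ m : Fin r, (fun y => (p i ((Δ i).symm y)).1 m) ⁻¹' {e.1.1 m}) ∩
        ⋂ m : Fin r, (fun y => (p i ((Δ i).symm y)).2 m) ⁻¹' {e.1.2 m}) ∩
        ⋂ k, d i k ⁻¹' {e.2 k} := by
      ext y
      simp [φ, Prod.ext_iff, funext_iff]
    have hpm := (hp i).comp (Δ i).symm.measurable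
    rw [he]
    exact ((MeasurableSet.iInter fun m : Fin r =>
      ((measurable_pi_apply (m : ℕ)).comp (measurable_fst.comp hpm))
        (measurableSet_singleton _)).inter
      (.iInter fun m : Fin r => ((measurable_pi_apply (m : ℕ)).comp (measurable_snd.comp hpm))
        (measurableSet_singleton _))).inter (.iInter fun k => hdm i k _)
  obtain ⟨i, j, hij, hlt⟩ := exists_ne_measure_ne_lt μ hφ (ε := 3 / 1000) (by norm_num)
  refine false_of_close_codes hr (hp i) (hp j) (fun h => hij (Subtype.ext (hb h))) (hA i) (hA j)
    (hθ i) (hΔ i) (hΔ j) (hd i) (hd j)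
    (le_trans (measure_mono (t := {y | φ i y ≠ φ j y}) ?_) hlt.le)
  intro y hy h
  have h1 := congrArg Prod.fst h
  refine hy ⟨fun m hm => ⟨?_, ?_⟩, fun k => congrFun (congrArg Prod.snd h) k⟩
  · exact sub_eq_zero.2 (congrFun (congrArg Prod.fst h1) ⟨m, hm⟩)
  · exact sub_eq_zero.2 (congrFun (congrArg Prod.snd h1) ⟨m, hm⟩)

theorem OrbitEquivalent.symm' {A B : PmpAction Γ X μ} (h : OrbitEquivalent A B) :
    OrbitEquivalent B A := by
  obtain ⟨Δ, h1, h2, h3, h4⟩ := h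
  let e : X ≃ᵐ X := ⟨Δ, h1, h2⟩
  have he : MeasurePreserving e.symm μ μ := MeasurePreserving.symm e h3
  refine ⟨Δ.symm, h2, by simpa using h1, he, ?_⟩
  filter_upwards [he.quasiMeasurePreserving.ae h4] with y hy
  have hy' : Δ '' A.orbit (Δ.symm y) = B.orbit (Δ (Δ.symm y)) := hy
  rw [Δ.apply_symm_apply] at hy'
  rw [← hy', Equiv.symm_image_image]

/-- A family whose index type is uncountable, and in which each member is related to countably
many members, contains an uncountable family of pairwise unrelated members. -/
theorem exists_uncountable_pairwise_not {ι : Type*} [Uncountable ι] {E : ι → ι → Prop}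
    (hs : ∀ i j, E i j → E j i) (hE : ∀ j, {i | E i j}.Countable) :
    ∃ S : Set ι, Uncountable S ∧ ∀ i ∈ S, ∀ j ∈ S, i ≠ j → ¬ E i j := by
  obtain ⟨S, hS⟩ := zorn_subset {S : Set ι | ∀ i ∈ S, ∀ j ∈ S, i ≠ j → ¬ E i j} <| by
    refine fun C hC hch => ⟨⋃₀ C, ?_, fun s hs => subset_sUnion_of_mem hs⟩
    rintro i ⟨s, hs, hi⟩ j ⟨t, ht, hj⟩
    rcases hch.total hs ht with h | h
    · exact hC ht i (h hi) j hj
    · exact hC hs i hi j (h hj)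
  refine ⟨S, not_countable_iff.1 fun hcount => ?_, hS.prop⟩
  have hSc : S.Countable := hcount
  have hun : (univ : Set ι) = S ∪ ⋃ j ∈ S, {i | E i j} := by
    refine (eq_univ_of_forall fun i => ?_).symm
    by_contra hi
    simp only [mem_union, mem_iUnion, mem_ofPred_eq, exists_prop, not_or, not_exists, not_and] at hi
    refine hi.1 (hS.le_of_ge (y := insert i S) ?_ (subset_insert _ _) (mem_insert _ _))
    rintro a (rfl | ha) b (rfl | hb) hab
    · exact absurd rfl hab
    · exact fun h => hi.2 b hb h
    · exact fun h => hi.2 a ha (hs _ _ h)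
    · exact hS.prop a ha b hb hab
  have : (univ : Set ι).Countable := hun ▸ hSc.union (hSc.biUnion fun j _ => hE j)
  exact not_countable (α := ι) (countable_univ_iff.1 this)

end Countability

end Auxiliary

/-- Epstein: every nonamenable countable discrete group admits uncountably many pairwise
non-orbit-equivalent free ergodic pmp actions on a nonatomic standard probability space. -/
theorem uncountably_many_non_OE_actions (Γ : Type) [Group Γ] [Countable Γ]
    (hna : ¬ IsAmenable Γ) :
    ∃ (X : Type) (_ : MeasurableSpace X) (μ : Measure X),
      StandardBorelSpace X ∧ IsProbabilityMeasure μ ∧ NoAtoms μ ∧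
      ∃ (ι : Type) (_ : Uncountable ι) (A : ι → PmpAction Γ X μ),
        (∀ i, (A i).IsFree ∧ (A i).IsErgodic) ∧
        ∀ i j, i ≠ j → ¬ OrbitEquivalent (A i) (A j) := by
  obtain ⟨X, _, _, μ, _, _, A, c, p, hA, hc, hp, he, hθ⟩ := exists_family_of_actions hna
    (coinMeasure.prod coinMeasure) (fun b : LabelSpace => labelPerm (r := 160000) b)
    (fun b k => measurePreserving_labelPerm b k) (fun b k => measurePreserving_labelPerm b k)
    (η := ENNReal.ofReal (3 / 1000)) (by simp)
  have : Uncountable LabelSpace := by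
    have hR : Uncountable (ℕ → ZMod 2) := by
      rw [← Cardinal.aleph0_lt_mk_iff, Cardinal.mk_arrow]
      simpa using Cardinal.cantor Cardinal.aleph0
    exact Function.Injective.uncountable (f := fun x : ℕ → ZMod 2 => (x, x))
      fun x y h => congrArg Prod.fst h
  obtain ⟨S, hS, hSE⟩ := exists_uncountable_pairwise_not
    (E := fun i j => OrbitEquivalent (A i) (A j)) (fun _ _ h => h.symm') fun j =>
      countable_setOf_orbitEquivalent rfl Function.injective_id hc hp he hθ (A j)
  exact ⟨X, _, μ, inferInstance, inferInstance, inferInstanceAs (NullSingletonClass μ), S, hS,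
    fun i => A i,
    fun i => hA i, fun i j hij => hSE i i.2 j j.2 fun h => hij (Subtype.ext h)⟩

end
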